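/- arXiv:1112.2351 — 2 statements merged into one kernel-verified Lean document; each statement's English description precedes it below -/
import Mathlib

section
/- Let p, r : [0,1] → ℝ be continuous with p(x) > 0 and r(x) > 0 for all x ∈ [0,1], let α ≥ 0, and let n ≥ 1. Suppose λ ∈ ℝ is an eigenvalue of the problem (p·y'')'' = λ·r·y with boundary conditions y(0) = y'(0) = y'(1) = 0 and (p·y'')'(1) + λ·α·y(1) = 0, suppose the set of eigenvalues μ of this problem with μ < λ has exactly n − 1 elements, and let y be a nontrivial classical solution at λ. Then the set {x ∈ (0,1) : y(x) = 0} has exactly n − 1 elements, and y'(a) ≠ 0 for every a ∈ (0,1) with y(a) = 0. -/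
open Set

/-- Derivative within the interval `[0,1]`. -/
noncomputable def Dv (y : ℝ → ℝ) : ℝ → ℝ := derivWithin y (Set.Icc 0 1)

/-- `y` is not identically zero on `[0,1]`. -/
def Nontriv (y : ℝ → ℝ) : Prop := ∃ x ∈ Set.Icc (0:ℝ) 1, y x ≠ 0

/-- `y` is a classical solution of `(p y'')'' = lam * r * y` on `[0,1]`. -/
def SolS (p r : ℝ → ℝ) (lam : ℝ) (y : ℝ → ℝ) : Prop :=
  ContDiffOn ℝ 2 y (Set.Icc 0 1) ∧
  ContDiffOn ℝ 2 (fun x => p x * Dv (Dv y) x) (Set.Icc 0 1) ∧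
  ∀ x ∈ Set.Icc (0:ℝ) 1,
    Dv (Dv (fun t => p t * Dv (Dv y) t)) x = lam * (r x * y x)

/-- Clamped boundary conditions `y(0) = y'(0) = y(1) = y'(1) = 0`. -/
def BC1 (y : ℝ → ℝ) : Prop := y 0 = 0 ∧ Dv y 0 = 0 ∧ y 1 = 0 ∧ Dv y 1 = 0

/-- Boundary conditions `y(0) = y'(0) = y'(1) = 0`, `(p y'')'(1) + lam * alpha * y(1) = 0`. -/
def BC2S (p : ℝ → ℝ) (lam alpha : ℝ) (y : ℝ → ℝ) : Prop :=
  y 0 = 0 ∧ Dv y 0 = 0 ∧ Dv y 1 = 0 ∧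
  Dv (fun t => p t * Dv (Dv y) t) 1 + lam * alpha * y 1 = 0

/-- Linear dependence of two functions on `[0,1]`. -/
def LinDep (y₁ y₂ : ℝ → ℝ) : Prop :=
  ∃ a b : ℝ, (a ≠ 0 ∨ b ≠ 0) ∧ ∀ x ∈ Set.Icc (0:ℝ) 1, a * y₁ x + b * y₂ x = 0

/-- `lam` is an eigenvalue of `(p y'')'' = lam r y` with boundary conditions (BC2_S). -/
def EigS2 (p r : ℝ → ℝ) (alpha lam : ℝ) : Prop :=
  ∃ y : ℝ → ℝ, SolS p r lam y ∧ Nontriv y ∧ BC2S p lam alpha y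

namespace Osc

/-- strict alternation at `k` points of `(a,b)`. -/
def Alt (g : ℝ → ℝ) : ℕ → ℝ → ℝ → ℝ → Prop
  | 0, _, a, b => a < b
  | k+1, s, a, b => ∃ x, a < x ∧ x < b ∧ 0 < s * g x ∧ Alt g k (-s) x b

/-- weak alternation at `k` points of `(a,b)`. -/
def WAlt (g : ℝ → ℝ) : ℕ → ℝ → ℝ → ℝ → Prop
  | 0, _, a, b => a < b
  | k+1, s, a, b => ∃ x, a < x ∧ x < b ∧ 0 ≤ s * g x ∧ WAlt g k (-s) x b

lemma Alt.lt {g : ℝ → ℝ} {k : ℕ} {s a b : ℝ} (h : Alt g k s a b) : a < b := by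
  cases k with
  | zero => exact h
  | succ k => obtain ⟨x, h1, h2, _⟩ := h; exact h1.trans h2

lemma WAlt.lt {g : ℝ → ℝ} {k : ℕ} {s a b : ℝ} (h : WAlt g k s a b) : a < b := by
  cases k with
  | zero => exact h
  | succ k => obtain ⟨x, h1, h2, _⟩ := h; exact h1.trans h2

lemma Alt.weak {g : ℝ → ℝ} {k : ℕ} {s a b : ℝ} (h : Alt g k s a b) : WAlt g k s a b := by
  induction k generalizing s a with
  | zero => exact h
  | succ k ih => obtain ⟨x, h1, h2, h3, h4⟩ := h; exact ⟨x, h1, h2, h3.le, ih h4⟩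

lemma Alt.left {g : ℝ → ℝ} {k : ℕ} {s a a' b : ℝ} (h : Alt g k s a b) (ha : a' ≤ a) :
    Alt g k s a' b := by
  cases k with
  | zero => exact ha.trans_lt h
  | succ k => obtain ⟨x, h1, h2, h3⟩ := h; exact ⟨x, ha.trans_lt h1, h2, h3⟩

lemma WAlt.left {g : ℝ → ℝ} {k : ℕ} {s a a' b : ℝ} (h : WAlt g k s a b) (ha : a' ≤ a) :
    WAlt g k s a' b := by
  cases k with
  | zero => exact ha.trans_lt h
  | succ k => obtain ⟨x, h1, h2, h3⟩ := h; exact ⟨x, ha.trans_lt h1, h2, h3⟩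

lemma Alt.imp {f g : ℝ → ℝ} {k : ℕ} {s a b : ℝ} (h : Alt f k s a b)
    (H : ∀ x s, a < x → x < b → 0 < s * f x → 0 < s * g x) : Alt g k s a b := by
  induction k generalizing s a with
  | zero => exact h
  | succ k ih =>
    obtain ⟨x, h1, h2, h3, h4⟩ := h
    exact ⟨x, h1, h2, H _ _ h1 h2 h3, ih h4 (fun y s hy => H y s (h1.trans hy))⟩

/-- scaling of the sign -/
lemma Alt.sign {g : ℝ → ℝ} {k : ℕ} {s t a b : ℝ} (h : Alt g k s a b) (ht : 0 < t) :
    Alt g k (t * s) a b := by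
  induction k generalizing s a with
  | zero => exact h
  | succ k ih =>
    obtain ⟨x, h1, h2, h3, h4⟩ := h
    refine ⟨x, h1, h2, ?_, ?_⟩
    · rw [mul_assoc]; positivity
    · have := ih h4; rwa [mul_neg] at this

/-- Combinatorial Rolle step. -/
lemma step {g G : ℝ → ℝ} {k : ℕ} {s a b : ℝ} (ha : 0 ≤ a) (hb : b ≤ 1) (hs : s ≠ 0)
    (hM : ∀ x y s, 0 ≤ x → x < y → y ≤ 1 → s ≠ 0 → s * g x ≤ 0 → 0 ≤ s * g y →
      ∃ t, x < t ∧ t < y ∧ 0 < s * G t)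
    (h0 : s * g a ≤ 0) (h : WAlt g k s a b) : Alt G k s a b := by
  induction k generalizing s a with
  | zero => exact h
  | succ k ih =>
    obtain ⟨x, h1, h2, h3, h4⟩ := h
    obtain ⟨t, t1, t2, t3⟩ := hM a x s ha h1 (h2.le.trans hb) hs h0 h3
    exact ⟨t, t1, t2.trans h2, t3,
      (ih (ha.trans h1.le) (neg_ne_zero.2 hs) (by linarith) h4).left t2.le⟩

/-- Combinatorial Rolle step with an end condition. -/
lemma stepEnd {g G : ℝ → ℝ} {k : ℕ} {s a b : ℝ} (ha : 0 ≤ a) (hb : b ≤ 1) (hs : s ≠ 0)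
    (hM : ∀ x y s, 0 ≤ x → x < y → y ≤ 1 → s ≠ 0 → s * g x ≤ 0 → 0 ≤ s * g y →
      ∃ t, x < t ∧ t < y ∧ 0 < s * G t)
    (hE : ∀ x s, 0 ≤ x → x < b → s ≠ 0 → s * g x ≤ 0 → ∃ t, x < t ∧ t < b ∧ 0 < s * G t)
    (h0 : s * g a ≤ 0) (h : WAlt g k s a b) : Alt G (k+1) s a b := by
  induction k generalizing s a with
  | zero =>
    obtain ⟨t, t1, t2, t3⟩ := hE a s ha h hs h0
    exact ⟨t, t1, t2, t3, t2⟩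
  | succ k ih =>
    obtain ⟨x, h1, h2, h3, h4⟩ := h
    obtain ⟨t, t1, t2, t3⟩ := hM a x s ha h1 (h2.le.trans hb) hs h0 h3
    exact ⟨t, t1, t2.trans h2, t3,
      (ih (ha.trans h1.le) (neg_ne_zero.2 hs) (by linarith) h4).left t2.le⟩

/-- not identically zero on any interval -/
def Nondeg (g : ℝ → ℝ) : Prop := ∀ x y : ℝ, 0 ≤ x → x < y → y ≤ 1 → ∃ t, x < t ∧ t < y ∧ g t ≠ 0

/-- `g'` is the derivative of `g` on `[0,1]`. -/
def Der (g g' : ℝ → ℝ) : Prop := ∀ x ∈ Icc (0:ℝ) 1, HasDerivWithinAt g (g' x) (Icc 0 1) x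

lemma Der.cont {g g' : ℝ → ℝ} (h : Der g g') : ContinuousOn g (Icc 0 1) :=
  fun x hx => (h x hx).continuousWithinAt

lemma Der.at {g g' : ℝ → ℝ} (h : Der g g') {x : ℝ} (h0 : 0 < x) (h1 : x < 1) :
    HasDerivAt g (g' x) x :=
  (h x ⟨h0.le, h1.le⟩).hasDerivAt (Icc_mem_nhds h0 h1)

lemma Der.smul {g g' : ℝ → ℝ} (h : Der g g') (c : ℝ) :
    Der (fun x => c * g x) (fun x => c * g' x) := fun x hx => (h x hx).const_mul c

lemma Der.add {g g' f f' : ℝ → ℝ} (h : Der g g') (h' : Der f f') :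
    Der (fun x => g x + f x) (fun x => g' x + f' x) := fun x hx => (h x hx).add (h' x hx)

lemma Der.mul {g g' f f' : ℝ → ℝ} (h : Der g g') (h' : Der f f') :
    Der (fun x => g x * f x) (fun x => g' x * f x + g x * f' x) :=
  fun x hx => (h x hx).mul (h' x hx)

lemma Der.congr {g g' f f' : ℝ → ℝ} (h : Der g g') (e : ∀ x ∈ Icc (0:ℝ) 1, f x = g x)
    (e' : ∀ x ∈ Icc (0:ℝ) 1, f' x = g' x) : Der f f' :=
  fun x hx => by
    rw [e' x hx]
    exact (h x hx).congr e (e x hx)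

lemma Der.anti {g g' : ℝ → ℝ} (h : Der g g') {x y : ℝ} (hx : 0 ≤ x) (hy : y ≤ 1)
    (H : ∀ t, x < t → t < y → g' t ≤ 0) : AntitoneOn g (Icc x y) := by
  apply antitoneOn_of_deriv_nonpos (convex_Icc x y)
    (h.cont.mono (Icc_subset_Icc hx hy))
  · rw [interior_Icc]
    intro t ht
    exact (h.at (hx.trans_lt ht.1) (ht.2.trans_le hy)).differentiableAt.differentiableWithinAt
  · rw [interior_Icc]
    intro t ht
    rw [(h.at (hx.trans_lt ht.1) (ht.2.trans_le hy)).deriv]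
    exact H t ht.1 ht.2

lemma Der.nondeg {g g' : ℝ → ℝ} (h : Der g g') (hn : Nondeg g') : Nondeg g := by
  intro x y hx hxy hy
  by_contra! hc
  obtain ⟨t, h1, h2, h3⟩ := hn x y hx hxy hy
  apply h3
  have e : g =ᶠ[nhds t] fun _ => 0 := by
    filter_upwards [Ioo_mem_nhds h1 h2] with z hz using hc z hz.1 hz.2
  have := (h.at (hx.trans_lt h1) (h2.trans_le hy)).congr_of_eventuallyEq e.symm
  exact this.unique (hasDerivAt_const t 0)

lemma Der.mvt {g g' : ℝ → ℝ} (h : Der g g') (hn : Nondeg g) :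
    ∀ x y s, 0 ≤ x → x < y → y ≤ 1 → s ≠ 0 → s * g x ≤ 0 → 0 ≤ s * g y →
      ∃ t, x < t ∧ t < y ∧ 0 < s * g' t := by
  intro x y s hx hxy hy hs h1 h2
  by_contra! hc
  obtain ⟨t, t1, t2, t3⟩ := hn x y hx hxy hy
  have A := (h.smul s).anti hx hy hc
  have a1 := A ⟨le_rfl, hxy.le⟩ ⟨t1.le, t2.le⟩ t1.le
  have a2 := A ⟨t1.le, t2.le⟩ ⟨hxy.le, le_rfl⟩ t2.le
  simp only at a1 a2
  have : s * g t = 0 := by linarith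
  rcases mul_eq_zero.1 this with h | h
  · exact hs h
  · exact t3 h

/-- Rolle -/
lemma Der.rolle {g g' : ℝ → ℝ} (h : Der g g') {x y : ℝ} (hx : 0 ≤ x) (hxy : x < y) (hy : y ≤ 1)
    (e : g x = g y) : ∃ t, x < t ∧ t < y ∧ g' t = 0 := by
  obtain ⟨t, ht, e⟩ := exists_hasDerivAt_eq_zero hxy (h.cont.mono (Icc_subset_Icc hx hy)) e
    (fun t ht => h.at (hx.trans_lt ht.1) (ht.2.trans_le hy))
  exact ⟨t, ht.1, ht.2, e⟩

structure Hyp (p r : ℝ → ℝ) (α : ℝ) : Prop where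
  pc : ContinuousOn p (Icc 0 1)
  rc : ContinuousOn r (Icc 0 1)
  pp : ∀ x ∈ Icc (0:ℝ) 1, 0 < p x
  rp : ∀ x ∈ Icc (0:ℝ) 1, 0 < r x
  ap : 0 ≤ α

structure Sys (p r : ℝ → ℝ) (α : ℝ) (u u1 w w1 f : ℝ → ℝ) : Prop where
  d0 : Der u u1
  d1 : Der u1 (fun x => w x / p x)
  d2 : Der w w1
  d3 : Der w1 (fun x => r x * f x)
  b0 : u 0 = 0
  b1 : u1 0 = 0
  b2 : u1 1 = 0
  b3 : w1 1 = -(α * f 1)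
  fc : ContinuousOn f (Icc 0 1)

section KL
variable {p r : ℝ → ℝ} {α : ℝ} {u u1 w w1 f : ℝ → ℝ}

lemma Sys.n1 (H : Hyp p r α) (S : Sys p r α u u1 w w1 f) (hf : Nondeg f) : Nondeg w1 := by
  apply S.d3.nondeg
  intro x y hx hxy hy
  obtain ⟨t, t1, t2, t3⟩ := hf x y hx hxy hy
  exact ⟨t, t1, t2, mul_ne_zero (H.rp t ⟨hx.trans t1.le, t2.le.trans hy⟩).ne' t3⟩

lemma Sys.n2 (H : Hyp p r α) (S : Sys p r α u u1 w w1 f) (hf : Nondeg f) : Nondeg w :=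
  S.d2.nondeg (S.n1 H hf)

lemma Sys.n3 (H : Hyp p r α) (S : Sys p r α u u1 w w1 f) (hf : Nondeg f) : Nondeg u1 := by
  apply S.d1.nondeg
  intro x y hx hxy hy
  obtain ⟨t, t1, t2, t3⟩ := S.n2 H hf x y hx hxy hy
  exact ⟨t, t1, t2, div_ne_zero t3 (H.pp t ⟨hx.trans t1.le, t2.le.trans hy⟩).ne'⟩

lemma Sys.n4 (H : Hyp p r α) (S : Sys p r α u u1 w w1 f) (hf : Nondeg f) : Nondeg u :=
  S.d0.nondeg (S.n3 H hf)

lemma Sys.mw (H : Hyp p r α) (S : Sys p r α u u1 w w1 f) (hf : Nondeg f) :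
    ∀ x y s, 0 ≤ x → x < y → y ≤ 1 → s ≠ 0 → s * u1 x ≤ 0 → 0 ≤ s * u1 y →
      ∃ t, x < t ∧ t < y ∧ 0 < s * w t := by
  intro x y s hx hxy hy hs h1 h2
  obtain ⟨t, t1, t2, t3⟩ := S.d1.mvt (S.n3 H hf) x y s hx hxy hy hs h1 h2
  refine ⟨t, t1, t2, ?_⟩
  have hp := H.pp t ⟨hx.trans t1.le, t2.le.trans hy⟩
  have : s * w t = s * (w t / p t) * p t := by field_simp
  rw [this]; positivity

lemma Sys.mf (H : Hyp p r α) (S : Sys p r α u u1 w w1 f) (hf : Nondeg f) :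
    ∀ x y s, 0 ≤ x → x < y → y ≤ 1 → s ≠ 0 → s * w1 x ≤ 0 → 0 ≤ s * w1 y →
      ∃ t, x < t ∧ t < y ∧ 0 < s * f t := by
  intro x y s hx hxy hy hs h1 h2
  obtain ⟨t, t1, t2, t3⟩ := S.d3.mvt (S.n1 H hf) x y s hx hxy hy hs h1 h2
  refine ⟨t, t1, t2, ?_⟩
  have hp := H.rp t ⟨hx.trans t1.le, t2.le.trans hy⟩
  have : s * (r t * f t) = (s * f t) * r t := by ring
  rw [this] at t3
  exact pos_of_mul_pos_left t3 hp.le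

lemma Sys.ef (H : Hyp p r α) (S : Sys p r α u u1 w w1 f) (hf : Nondeg f) :
    ∀ x s, 0 ≤ x → x < 1 → s ≠ 0 → s * w1 x ≤ 0 → ∃ t, x < t ∧ t < 1 ∧ 0 < s * f t := by
  intro x s hx hx1 hs h1
  by_cases h : 0 < s * f 1
  · have hc : ContinuousWithinAt (fun x => s * f x) (Icc 0 1) 1 :=
      (continuousOn_const.mul S.fc) 1 ⟨zero_le_one, le_rfl⟩
    have hc' : ContinuousWithinAt (fun x => s * f x) (Iio 1) 1 := by
      have : ContinuousWithinAt (fun x => s * f x) (Ico 0 1) 1 := hc.mono Ico_subset_Icc_self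
      have e : nhdsWithin (1:ℝ) (Ico 0 1) = nhdsWithin 1 (Iio 1) :=
        nhdsWithin_Ico_eq_nhdsLT zero_lt_one
      unfold ContinuousWithinAt at *
      rwa [e] at this
    have := hc'.eventually (lt_mem_nhds h)
    obtain ⟨t, ht1, ht2⟩ := (this.and (Ioo_mem_nhdsLT hx1)).exists
    exact ⟨t, ht2.1, ht2.2, ht1⟩
  · apply S.mf H hf x 1 s hx hx1 le_rfl hs h1
    rw [S.b3]
    have := H.ap
    push Not at h
    nlinarith

lemma Sys.A (H : Hyp p r α) (S : Sys p r α u u1 w w1 f) (hf : Nondeg f) {m : ℕ} {s : ℝ}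
    (hs : s ≠ 0) (h : WAlt u m s 0 1) : Alt u1 m s 0 1 :=
  step le_rfl le_rfl hs (S.d0.mvt (S.n4 H hf)) (by simp [S.b0]) h

lemma Sys.A' (H : Hyp p r α) (S : Sys p r α u u1 w w1 f) (hf : Nondeg f) {m : ℕ} {s : ℝ}
    (hs : s ≠ 0) (h1 : u 1 = 0) (h : WAlt u m s 0 1) : Alt u1 (m+1) s 0 1 :=
  stepEnd le_rfl le_rfl hs (S.d0.mvt (S.n4 H hf))
    (fun x s hx hx1 hs h => S.d0.mvt (S.n4 H hf) x 1 s hx hx1 le_rfl hs h (by simp [h1]))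
    (by simp [S.b0]) h

lemma Sys.B (H : Hyp p r α) (S : Sys p r α u u1 w w1 f) (hf : Nondeg f) {m : ℕ} {s : ℝ}
    (hs : s ≠ 0) (h : WAlt u1 m s 0 1) : Alt w (m+1) s 0 1 :=
  stepEnd le_rfl le_rfl hs (S.mw H hf)
    (fun x s hx hx1 hs h => S.mw H hf x 1 s hx hx1 le_rfl hs h (by simp [S.b2]))
    (by simp [S.b1]) h

lemma Sys.C (H : Hyp p r α) (S : Sys p r α u u1 w w1 f) (hf : Nondeg f) {m : ℕ} {s : ℝ}
    (hs : s ≠ 0) (h : Alt w (m+1) s 0 1) : Alt w1 m (-s) 0 1 := by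
  obtain ⟨x, h1, h2, h3, h4⟩ := h
  exact (step h1.le le_rfl (neg_ne_zero.2 hs) (S.d2.mvt (S.n2 H hf)) (by linarith) h4.weak).left h1.le

lemma Sys.C' (H : Hyp p r α) (S : Sys p r α u u1 w w1 f) (hf : Nondeg f) {m : ℕ} {s : ℝ}
    (hs : s ≠ 0) (h0 : w 0 = 0) (h : Alt w m s 0 1) : Alt w1 m s 0 1 :=
  step le_rfl le_rfl hs (S.d2.mvt (S.n2 H hf)) (by simp [h0]) h.weak

lemma Sys.D (H : Hyp p r α) (S : Sys p r α u u1 w w1 f) (hf : Nondeg f) {m : ℕ} {s : ℝ}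
    (hs : s ≠ 0) (h : Alt w1 (m+1) s 0 1) : Alt f (m+1) (-s) 0 1 := by
  obtain ⟨x, h1, h2, h3, h4⟩ := h
  exact (stepEnd h1.le le_rfl (neg_ne_zero.2 hs) (S.mf H hf) (S.ef H hf) (by linarith)
    h4.weak).left h1.le

/-- from `u1` to `f` -/
lemma Sys.BD (H : Hyp p r α) (S : Sys p r α u u1 w w1 f) (hf : Nondeg f) {m : ℕ} {s : ℝ}
    (hs : s ≠ 0) (h : WAlt u1 (m+1) s 0 1) : Alt f (m+1) s 0 1 := by
  have := S.D H hf (neg_ne_zero.2 hs) (S.C H hf hs (S.B H hf hs h))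
  rwa [neg_neg] at this

/-- variation diminishing -/
lemma Sys.KL (H : Hyp p r α) (S : Sys p r α u u1 w w1 f) (hf : Nondeg f) {m : ℕ} {s : ℝ}
    (hs : s ≠ 0) (h : WAlt u (m+1) s 0 1) : Alt f (m+1) s 0 1 :=
  S.BD H hf hs (S.A H hf hs h).weak

lemma Sys.KL1 (H : Hyp p r α) (S : Sys p r α u u1 w w1 f) (hf : Nondeg f) {m : ℕ} {s : ℝ}
    (hs : s ≠ 0) (h1 : u 1 = 0) (h : WAlt u (m+1) s 0 1) : Alt f (m+2) s 0 1 :=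
  S.BD H hf hs (S.A' H hf hs h1 h).weak

lemma Sys.KL0 (H : Hyp p r α) (S : Sys p r α u u1 w w1 f) (hf : Nondeg f) {m : ℕ} {s : ℝ}
    (hs : s ≠ 0) (h0 : w 0 = 0) (h : WAlt u (m+1) s 0 1) : Alt f (m+2) (-s) 0 1 :=
  S.D H hf hs (S.C' H hf hs h0 (S.B H hf hs (S.A H hf hs h).weak))

end KL
end Osc

namespace Osc

lemma Alt.zeros_aux {g : ℝ → ℝ} {m : ℕ} {s a b : ℝ} (hg : ContinuousOn g (Icc 0 1))
    (ha : 0 ≤ a) (hb : b ≤ 1) (h0 : s * g a < 0) (h : Alt g m s a b) :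
    ∃ Z : Finset ℝ, Z.card = m ∧ ∀ z ∈ Z, a < z ∧ z < b ∧ g z = 0 := by
  classical
  induction m generalizing s a with
  | zero => exact ⟨∅, rfl, by simp⟩
  | succ m ih =>
    obtain ⟨x, h1, h2, h3, h4⟩ := h
    obtain ⟨Z, hZ, hz⟩ := ih (ha.trans h1.le) (by linarith) h4
    have hc : ContinuousOn (fun t => s * g t) (Icc a x) :=
      continuousOn_const.mul (hg.mono (Icc_subset_Icc ha (h2.le.trans hb)))
    obtain ⟨z, hz1, hz2⟩ := intermediate_value_Ioo h1.le hc (show (0:ℝ) ∈ Ioo _ _ from ⟨h0, h3⟩)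
    have hs : s ≠ 0 := by rintro rfl; simp at h0
    have hz3 : g z = 0 := by
      rcases mul_eq_zero.1 hz2 with h | h
      · exact absurd h hs
      · exact h
    refine ⟨insert z Z, ?_, ?_⟩
    · rw [Finset.card_insert_of_notMem, hZ]
      intro hzZ
      exact absurd (hz z hzZ).1 (not_lt.2 hz1.2.le)
    · intro t ht
      rcases Finset.mem_insert.1 ht with rfl | ht
      · exact ⟨hz1.1, hz1.2.trans h2, hz3⟩
      · exact ⟨h1.trans (hz t ht).1, (hz t ht).2⟩

lemma Alt.zeros {g : ℝ → ℝ} {m : ℕ} {s : ℝ} (hg : ContinuousOn g (Icc 0 1))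
    (h : Alt g (m+1) s 0 1) :
    ∃ Z : Finset ℝ, Z.card = m ∧ ∀ z ∈ Z, 0 < z ∧ z < 1 ∧ g z = 0 := by
  obtain ⟨x, h1, h2, h3, h4⟩ := h
  obtain ⟨Z, hZ, hz⟩ := Alt.zeros_aux hg h1.le le_rfl (by linarith) h4
  exact ⟨Z, hZ, fun z hz' => ⟨h1.trans (hz z hz').1, (hz z hz').2⟩⟩

lemma WAlt.of_zeros {g : ℝ → ℝ} {m : ℕ} {a b : ℝ} (s : ℝ) (hab : a < b) (Z : Finset ℝ)
    (hc : Z.card = m) (hz : ∀ z ∈ Z, a < z ∧ z < b ∧ g z = 0) : WAlt g m s a b := by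
  classical
  induction m generalizing s a Z with
  | zero => exact hab
  | succ m ih =>
    have hne : Z.Nonempty := Finset.card_pos.1 (by omega)
    have hm := Z.min'_mem hne
    obtain ⟨h1, h2, h3⟩ := hz _ hm
    refine ⟨Z.min' hne, h1, h2, by simp [h3], ?_⟩
    apply ih (-s) h2 (Z.erase (Z.min' hne))
    · rw [Finset.card_erase_of_mem hm, hc]; rfl
    · intro z hz'
      obtain ⟨e1, e2⟩ := Finset.mem_erase.1 hz'
      exact ⟨lt_of_le_of_ne (Finset.min'_le _ _ e2) (Ne.symm e1), (hz z e2).2⟩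

/-- `m` zeros give `m+1` weakly alternating points. -/
lemma WAlt.of_zeros' {g : ℝ → ℝ} {m : ℕ} (Z : Finset ℝ)
    (hc : Z.card = m) (hz : ∀ z ∈ Z, 0 < z ∧ z < 1 ∧ g z = 0) :
    ∃ s, s ≠ 0 ∧ WAlt g (m+1) s 0 1 := by
  obtain ⟨x, h1, h2, h3⟩ : ∃ x, 0 < x ∧ x < 1 ∧ ∀ z ∈ Z, x < z := by
    have hne : (insert 1 Z).Nonempty := ⟨1, by simp⟩
    have hm := (insert 1 Z).min'_mem hne
    have h0 : 0 < (insert 1 Z).min' hne := by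
      rcases Finset.mem_insert.1 hm with h | h
      · rw [h]; norm_num
      · exact (hz _ h).1
    have hl : ∀ z ∈ insert 1 Z, (insert 1 Z).min' hne ≤ z := fun z hz => Finset.min'_le _ _ hz
    refine ⟨(insert 1 Z).min' hne / 2, by positivity, ?_, ?_⟩
    · have := hl 1 (by simp); linarith
    · intro z hz'
      have := hl z (by simp [hz']); linarith
  obtain ⟨s, hs, h⟩ : ∃ s : ℝ, s ≠ 0 ∧ 0 ≤ s * g x := by
    rcases le_total 0 (g x) with h | h
    · exact ⟨1, one_ne_zero, by simpa⟩
    · exact ⟨-1, by norm_num, by simpa⟩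
  exact ⟨s, hs, x, h1, h2, h, WAlt.of_zeros _ h2 Z hc
    (fun z hz' => ⟨h3 z hz', (hz z hz').2⟩)⟩

/-- openness of strict alternation -/
lemma Alt.eventually {ι : Type*} {l : Filter ι} {G : ι → ℝ → ℝ} {g : ℝ → ℝ} {m : ℕ} {s a b : ℝ}
    (h : Alt g m s a b) (hG : ∀ x, a < x → x < b → Filter.Tendsto (fun j => G j x) l (nhds (g x))) :
    ∀ᶠ j in l, Alt (G j) m s a b := by
  induction m generalizing s a with
  | zero => exact Filter.Eventually.of_forall fun _ => h
  | succ m ih =>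
    obtain ⟨x, h1, h2, h3, h4⟩ := h
    have e1 := ih h4 (fun y hy => hG y (h1.trans hy))
    have e2 := ((hG x h1 h2).const_mul s).eventually (lt_mem_nhds h3)
    filter_upwards [e1, e2] with j a1 a2 using ⟨x, h1, h2, a2, a1⟩

/-- `a` is an accumulation point of zeros. -/
def Acc (g : ℝ → ℝ) (a : ℝ) : Prop := ∀ ε > 0, ∃ z ∈ Icc (0:ℝ) 1, z ≠ a ∧ |z - a| < ε ∧ g z = 0

lemma Acc.zero {g : ℝ → ℝ} {a : ℝ} (hg : ContinuousOn g (Icc 0 1)) (ha : a ∈ Icc (0:ℝ) 1)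
    (h : Acc g a) : g a = 0 := by
  by_contra hne
  obtain ⟨δ, hδ, hd⟩ := Metric.continuousOn_iff.1 hg a ha |g a| (abs_pos.2 hne)
  obtain ⟨z, hz, -, hz2, hz3⟩ := h δ hδ
  have := hd z hz (by rwa [Real.dist_eq])
  rw [Real.dist_eq, hz3, zero_sub, abs_neg] at this
  exact lt_irrefl _ this

lemma Acc.der {g g' : ℝ → ℝ} {a : ℝ} (hg : Der g g') (ha : a ∈ Icc (0:ℝ) 1)
    (h : Acc g a) : Acc g' a := by
  have h0 := h.zero hg.cont ha
  intro ε hε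
  obtain ⟨z, hz, hz1, hz2, hz3⟩ := h ε hε
  rw [abs_lt] at hz2
  rcases lt_or_gt_of_ne hz1 with hlt | hlt
  · obtain ⟨t, t1, t2, t3⟩ := hg.rolle hz.1 hlt ha.2 (by rw [hz3, h0])
    exact ⟨t, ⟨hz.1.trans t1.le, t2.le.trans ha.2⟩, t2.ne, abs_lt.2 ⟨by linarith, by linarith⟩, t3⟩
  · obtain ⟨t, t1, t2, t3⟩ := hg.rolle ha.1 hlt hz.2 (by rw [hz3, h0])
    exact ⟨t, ⟨ha.1.trans t1.le, t2.le.trans hz.2⟩, t1.ne', abs_lt.2 ⟨by linarith, by linarith⟩, t3⟩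

section Eig
variable {p r : ℝ → ℝ} {α lam : ℝ} {y y1 w w1 : ℝ → ℝ}

lemma gronwall_zero {e e' : ℝ → ℝ} {K : ℝ} (h : Der e e') (hpos : ∀ x ∈ Icc (0:ℝ) 1, 0 ≤ e x)
    (hb : ∀ x ∈ Icc (0:ℝ) 1, |e' x| ≤ K * e x) {a : ℝ} (ha : a ∈ Icc (0:ℝ) 1) (h0 : e a = 0) :
    ∀ x ∈ Icc (0:ℝ) 1, e x = 0 := by
  intro x hx
  have dexp : ∀ c : ℝ, Der (fun t => Real.exp (c * t)) (fun t => c * Real.exp (c * t)) := by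
    intro c t _
    have := ((hasDerivAt_id t).const_mul c).exp
    simp only [id, mul_one] at this
    rw [mul_comm] at this
    exact this.hasDerivWithinAt
  rcases le_total a x with hax | hax
  · have A := (h.mul (dexp (-K))).anti ha.1 hx.2 (fun t h1 h2 => by
      have := hb t ⟨ha.1.trans h1.le, h2.le.trans hx.2⟩
      have := (abs_le.1 this).2
      have := Real.exp_pos (-K * t)
      nlinarith)
    have := A ⟨le_rfl, hax⟩ ⟨hax, le_rfl⟩ hax
    simp only [h0, zero_mul] at this
    have h2 := hpos x hx
    have := Real.exp_pos (-K * x)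
    nlinarith
  · have A := ((h.mul (dexp K)).smul (-1)).anti hx.1 ha.2 (fun t h1 h2 => by
      have := hb t ⟨hx.1.trans h1.le, h2.le.trans ha.2⟩
      have := (abs_le.1 this).1
      have := Real.exp_pos (K * t)
      nlinarith)
    have := A ⟨le_rfl, hax⟩ ⟨hax, le_rfl⟩ hax
    simp only [h0, zero_mul] at this
    have h2 := hpos x hx
    have := Real.exp_pos (K * x)
    nlinarith

lemma two_mul_bd (x y k : ℝ) : |2 * (x * y) * k| ≤ |k| * (x^2 + y^2) := by
  rw [abs_mul, mul_comm]
  apply mul_le_mul_of_nonneg_left _ (abs_nonneg k)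
  rw [abs_le]; constructor <;> nlinarith [sq_nonneg (x+y), sq_nonneg (x-y)]

lemma Sys.unique (H : Hyp p r α) (S : Sys p r α y y1 w w1 (fun x => lam * y x)) {a : ℝ}
    (ha : a ∈ Icc (0:ℝ) 1) (h0 : y a = 0) (h1 : y1 a = 0) (h2 : w a = 0) (h3 : w1 a = 0) :
    ∀ x ∈ Icc (0:ℝ) 1, y x = 0 := by
  obtain ⟨C1, hC1⟩ := isCompact_Icc.exists_bound_of_continuousOn
    (H.pc.inv₀ (fun x hx => (H.pp x hx).ne'))
  obtain ⟨C2, hC2⟩ := isCompact_Icc.exists_bound_of_continuousOn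
    (H.rc.mul (continuousOn_const (c := lam)))
  have D := ((S.d0.mul S.d0).add (S.d1.mul S.d1)).add ((S.d2.mul S.d2).add (S.d3.mul S.d3))
  have Z := gronwall_zero (K := 2 + C1 + C2) D (fun x _ => by nlinarith [sq_nonneg (y x), sq_nonneg (y1 x), sq_nonneg (w x), sq_nonneg (w1 x)])
    (fun x hx => by
      have i1 : |(p x)⁻¹| ≤ C1 := hC1 x hx
      have i2 : |r x * lam| ≤ C2 := hC2 x hx
      have e1 := two_mul_bd (y x) (y1 x) 1
      have e2 := two_mul_bd (y1 x) (w x) (p x)⁻¹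
      have e3 := two_mul_bd (w x) (w1 x) 1
      have e4 := two_mul_bd (y x) (w1 x) (r x * lam)
      have e2' := e2.trans (mul_le_mul_of_nonneg_right i1 (by positivity))
      have e4' := e4.trans (mul_le_mul_of_nonneg_right i2 (by positivity))
      rw [abs_one, one_mul] at e1 e3
      have c1 : 0 ≤ C1 := (abs_nonneg _).trans i1
      have c2 : 0 ≤ C2 := (abs_nonneg _).trans i2
      have := mul_nonneg c1 (sq_nonneg (y x))
      have := mul_nonneg c1 (sq_nonneg (w1 x))
      have := mul_nonneg c2 (sq_nonneg (y1 x))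
      have := mul_nonneg c2 (sq_nonneg (w x))
      rw [div_eq_mul_inv]
      rw [abs_le] at *
      constructor
      · nlinarith [sq_nonneg (y x), sq_nonneg (y1 x), sq_nonneg (w x), sq_nonneg (w1 x)]
      · nlinarith [sq_nonneg (y x), sq_nonneg (y1 x), sq_nonneg (w x), sq_nonneg (w1 x)])
    ha (by simp [h0, h1, h2, h3])
  intro x hx
  have := Z x hx
  nlinarith [sq_nonneg (y x), sq_nonneg (y1 x), sq_nonneg (w x), sq_nonneg (w1 x)]

lemma Sys.finite (H : Hyp p r α) (S : Sys p r α y y1 w w1 (fun x => lam * y x))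
    (hn : ∃ x ∈ Icc (0:ℝ) 1, y x ≠ 0) : {x ∈ Icc (0:ℝ) 1 | y x = 0}.Finite := by
  by_contra hinf
  obtain ⟨a, ha, hacc⟩ := Set.Infinite.exists_accPt_of_subset_isCompact hinf
    (isCompact_Icc (a := (0:ℝ)) (b := 1)) (sep_subset _ _)
  have A : Acc y a := by
    intro ε hε
    rw [accPt_iff_nhds] at hacc
    obtain ⟨z, ⟨h1, h2⟩, h3⟩ := hacc _ (Metric.ball_mem_nhds a hε)
    exact ⟨z, h2.1, h3, by rwa [Metric.mem_ball, Real.dist_eq] at h1, h2.2⟩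
  have A1 := A.der S.d0 ha
  have A2 : Acc w a := by
    intro ε hε
    obtain ⟨z, h1, h2, h3, h4⟩ := A1.der S.d1 ha ε hε
    refine ⟨z, h1, h2, h3, ?_⟩
    rcases div_eq_zero_iff.1 h4 with h | h
    · exact h
    · exact absurd h (H.pp z h1).ne'
  have A3 := A2.der S.d2 ha
  obtain ⟨x, hx, hne⟩ := hn
  exact hne (S.unique H ha (A.zero S.d0.cont ha) (A1.zero S.d1.cont ha) (A2.zero S.d2.cont ha)
    (A3.zero S.d3.cont ha) x hx)

end Eig
end Osc

namespace Osc

structure Eg (p r : ℝ → ℝ) (α lam : ℝ) (y y1 w w1 : ℝ → ℝ) : Prop where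
  S : Sys p r α y y1 w w1 (fun x => lam * y x)
  lp : 0 < lam
  nt : ∃ x ∈ Icc (0:ℝ) 1, y x ≠ 0

lemma Alt.of_smul {g : ℝ → ℝ} {c : ℝ} (hc : 0 < c) {m : ℕ} {s a b : ℝ}
    (h : Alt (fun x => c * g x) m s a b) : Alt g m s a b :=
  h.imp (fun x s _ _ h => by
    have : s * (c * g x) = c * (s * g x) := by ring
    rw [this] at h
    exact pos_of_mul_pos_right h hc.le)

lemma Nondeg.smul {g : ℝ → ℝ} {c : ℝ} (hc : c ≠ 0) (h : Nondeg g) : Nondeg (fun x => c * g x) := by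
  intro x y h1 h2 h3
  obtain ⟨t, t1, t2, t3⟩ := h x y h1 h2 h3
  exact ⟨t, t1, t2, mul_ne_zero hc t3⟩

section
variable {p r : ℝ → ℝ} {α lam : ℝ} {y y1 w w1 : ℝ → ℝ}

lemma Eg.nondeg (H : Hyp p r α) (E : Eg p r α lam y y1 w w1) : Nondeg y := by
  intro a b ha hab hb
  by_contra! hc
  apply (Ioo_infinite hab) ((E.S.finite H E.nt).subset _)
  intro t ht
  exact ⟨⟨ha.trans ht.1.le, ht.2.le.trans hb⟩, hc t ht.1 ht.2⟩

lemma Eg.nondeg' (H : Hyp p r α) (E : Eg p r α lam y y1 w w1) : Nondeg (fun x => lam * y x) :=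
  (E.nondeg H).smul E.lp.ne'

lemma Eg.finite (H : Hyp p r α) (E : Eg p r α lam y y1 w w1) :
    {x ∈ Ioo (0:ℝ) 1 | y x = 0}.Finite :=
  (E.S.finite H E.nt).subset (fun _ hx => ⟨Ioo_subset_Icc_self hx.1, hx.2⟩)

lemma Eg.le_card (H : Hyp p r α) (E : Eg p r α lam y y1 w w1) {m : ℕ} {s : ℝ}
    (h : Alt y (m+1) s 0 1) : m ≤ {x ∈ Ioo (0:ℝ) 1 | y x = 0}.ncard := by
  obtain ⟨Z, hZ, hz⟩ := h.zeros E.S.d0.cont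
  rw [← hZ, ← Set.ncard_coe_finset]
  apply Set.ncard_le_ncard _ (E.finite H)
  intro z hz'
  exact ⟨⟨(hz z hz').1, (hz z hz').2.1⟩, (hz z hz').2.2⟩

lemma Eg.K (H : Hyp p r α) (E : Eg p r α lam y y1 w w1) {m : ℕ} {s : ℝ} (hs : s ≠ 0)
    (h : WAlt y (m+1) s 0 1) : Alt y (m+1) s 0 1 :=
  (E.S.KL H (E.nondeg' H) hs h).of_smul E.lp

lemma Eg.base (H : Hyp p r α) (E : Eg p r α lam y y1 w w1) : ∃ s, s ≠ 0 ∧ Alt y 1 s 0 1 := by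
  obtain ⟨x, h1, h2, h3⟩ := E.nondeg H 0 1 le_rfl zero_lt_one le_rfl
  exact ⟨y x, h3, x, h1, h2, mul_self_pos.2 h3, h2⟩

lemma Eg.contra (H : Hyp p r α) (E : Eg p r α lam y y1 w w1)
    (h : ∀ m s, s ≠ 0 → Alt y (m+1) s 0 1 → ∃ t, t ≠ 0 ∧ Alt y (m+2) t 0 1) : False := by
  have : ∀ m, ∃ s, s ≠ 0 ∧ Alt y (m+1) s 0 1 := by
    intro m
    induction m with
    | zero => exact E.base H
    | succ m ih =>
      obtain ⟨s, hs, ha⟩ := ih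
      exact h m s hs ha
  obtain ⟨s, _, h⟩ := this ({x ∈ Ioo (0:ℝ) 1 | y x = 0}.ncard + 1)
  have := E.le_card H h
  omega

lemma Eg.ne1 (H : Hyp p r α) (E : Eg p r α lam y y1 w w1) : y 1 ≠ 0 := by
  intro h1
  exact E.contra H fun m s hs h =>
    ⟨s, hs, (E.S.KL1 H (E.nondeg' H) hs h1 h.weak).of_smul E.lp⟩

lemma Eg.ne0 (H : Hyp p r α) (E : Eg p r α lam y y1 w w1) : w 0 ≠ 0 := by
  intro h1
  exact E.contra H fun m s hs h =>
    ⟨-s, neg_ne_zero.2 hs, (E.S.KL0 H (E.nondeg' H) hs h1 h.weak).of_smul E.lp⟩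

lemma Eg.simple_aux (H : Hyp p r α) (E : Eg p r α lam y y1 w w1) {a : ℝ} (ha1 : a < 1)
    (hy : y a = 0) (hy1 : y1 a = 0) (k : ℕ) : ∀ (s c : ℝ), 0 ≤ c → c < a → s ≠ 0 → s * y c < 0 →
    Alt y k s c 1 → WAlt y (k+1) s c 1 ∨ WAlt y1 (k+2) s c 1 := by
  have M := E.S.d0.mvt (E.nondeg H)
  induction k with
  | zero =>
    intro s c hc hca hs h0 h
    left
    exact ⟨a, hca, ha1, by simp [hy], ha1⟩
  | succ k ih =>
    intro s c hc hca hs h0 h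
    obtain ⟨x, h1, h2, h3, h4⟩ := h
    rcases lt_trichotomy a x with hax | hax | hax
    · right
      obtain ⟨t, t1, t2, t3⟩ := M c a s hc hca ha1.le hs h0.le (by simp [hy])
      obtain ⟨t', t1', t2', t3'⟩ := M a x s (hc.trans hca.le) hax h2.le hs (by simp [hy]) h3.le
      refine ⟨t, t1, t2.trans ha1, t3.le, a, t2, ha1, by simp [hy1], t', t1', t2'.trans h2, ?_, ?_⟩
      · simpa using t3'.le
      · rw [neg_neg]
        exact ((step (hc.trans h1.le) le_rfl (neg_ne_zero.2 hs) M (by linarith) h4.weak).left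
          t2'.le).weak
    · rw [← hax, hy] at h3; simp at h3
    · rcases ih (-s) x (hc.trans h1.le) hax (neg_ne_zero.2 hs) (by linarith) h4 with h | h
      · left
        exact ⟨x, h1, h2, h3.le, h⟩
      · right
        obtain ⟨t, t1, t2, t3⟩ := M c x s hc h1 h2.le hs h0.le h3.le
        exact ⟨t, t1, t2.trans h2, t3.le, h.left t2.le⟩

lemma Eg.simple (H : Hyp p r α) (E : Eg p r α lam y y1 w w1) {a : ℝ} (ha0 : 0 < a) (ha1 : a < 1)
    (hy : y a = 0) : y1 a ≠ 0 := by
  intro hy1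
  refine E.contra H fun m s hs h => ?_
  obtain ⟨x, h1, h2, h3, h4⟩ := id h
  rcases lt_trichotomy a x with hax | hax | hax
  · refine ⟨-s, neg_ne_zero.2 hs, E.K H (neg_ne_zero.2 hs) ⟨a, ha0, ha1, by simp [hy], ?_⟩⟩
    rw [neg_neg]
    exact ⟨x, hax, h2, h3.le, h4.weak⟩
  · rw [← hax, hy] at h3; simp at h3
  · rcases E.simple_aux H ha1 hy hy1 m (-s) x h1.le hax (neg_ne_zero.2 hs) (by linarith) h4 with h | h
    · exact ⟨s, hs, E.K H hs ⟨x, h1, h2, h3.le, h⟩⟩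
    · exact ⟨-s, neg_ne_zero.2 hs,
        (E.S.BD H (E.nondeg' H) (neg_ne_zero.2 hs) (h.left h1.le)).of_smul E.lp⟩

lemma Eg.zeros_alt (H : Hyp p r α) (E : Eg p r α lam y y1 w w1) {m : ℕ} (Z : Finset ℝ)
    (hc : Z.card = m) (hz : ∀ z ∈ Z, 0 < z ∧ z < 1 ∧ y z = 0) :
    ∃ s, s ≠ 0 ∧ Alt y (m+1) s 0 1 := by
  obtain ⟨s, hs, h⟩ := WAlt.of_zeros' Z hc hz
  exact ⟨s, hs, E.K H hs h⟩

lemma Eg.alt_card (H : Hyp p r α) (E : Eg p r α lam y y1 w w1) :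
    ∃ s, s ≠ 0 ∧ Alt y ({x ∈ Ioo (0:ℝ) 1 | y x = 0}.ncard + 1) s 0 1 := by
  apply E.zeros_alt H (E.finite H).toFinset
  · rw [Set.ncard_eq_toFinset_card _ (E.finite H)]
  · intro z hz
    rw [Set.Finite.mem_toFinset] at hz
    exact ⟨hz.1.1, hz.1.2, hz.2⟩

end

lemma Der.zero {g g' : ℝ → ℝ} (h : Der g g') {x y : ℝ} (hx : 0 ≤ x) (hy : y ≤ 1)
    (H : ∀ t, x < t → t < y → g t = 0) : ∀ t, x < t → t < y → g' t = 0 := by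
  intro t h1 h2
  have e : g =ᶠ[nhds t] fun _ => 0 := by
    filter_upwards [Ioo_mem_nhds h1 h2] with z hz using H z hz.1 hz.2
  have := (h.at (hx.trans_lt h1) (h2.trans_le hy)).congr_of_eventuallyEq e.symm
  exact this.unique (hasDerivAt_const t 0)

/-- limits of zeros of perturbations -/
lemma zero_lim {f g : ℝ → ℝ} (hf : ContinuousOn f (Icc 0 1)) (hg : ContinuousOn g (Icc 0 1))
    {ε : ℕ → ℝ} (hε : Filter.Tendsto ε Filter.atTop (nhds 0)) {x : ℕ → ℝ} {a : ℝ}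
    (hx : ∀ j, x j ∈ Icc (0:ℝ) 1) (ha : Filter.Tendsto x Filter.atTop (nhds a))
    (h0 : ∀ j, f (x j) + ε j * g (x j) = 0) : f a = 0 := by
  have haI : a ∈ Icc (0:ℝ) 1 := isClosed_Icc.mem_of_tendsto ha (Filter.Eventually.of_forall hx)
  have ha' : Filter.Tendsto x Filter.atTop (nhdsWithin a (Icc 0 1)) :=
    tendsto_nhdsWithin_iff.2 ⟨ha, Filter.Eventually.of_forall hx⟩
  have t1 := (hf a haI).tendsto.comp ha'
  have t2 := (hg a haI).tendsto.comp ha'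
  have t3 := t1.add (hε.mul t2)
  have : Filter.Tendsto (fun j => f (x j) + ε j * g (x j)) Filter.atTop (nhds 0) := by
    simp only [h0]; exact tendsto_const_nhds
  have := tendsto_nhds_unique t3 this
  simpa using this

section
variable {p r : ℝ → ℝ} {α lam mu : ℝ} {y y1 w w1 z z1 v v1 : ℝ → ℝ}

lemma Eg.usc (H : Hyp p r α) (E : Eg p r α lam y y1 w w1) (E' : Eg p r α mu z z1 v v1)
    {ε : ℕ → ℝ} (hε : Filter.Tendsto ε Filter.atTop (nhds 0)) {m : ℕ}
    (h : ∀ j, ∃ Z : Finset ℝ, Z.card = m ∧ ∀ t ∈ Z, 0 < t ∧ t < 1 ∧ z t + ε j * y t = 0) :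
    ∃ Z : Finset ℝ, Z.card = m ∧ ∀ t ∈ Z, 0 < t ∧ t < 1 ∧ z t = 0 := by
  choose Z hZ hz using h
  let X : ℕ → Fin m → ℝ := fun j => (Z j).orderEmbOfFin (hZ j)
  have hX : ∀ j i, 0 < X j i ∧ X j i < 1 ∧ z (X j i) + ε j * y (X j i) = 0 := fun j i =>
    hz j _ (Finset.orderEmbOfFin_mem _ _ _)
  have hmono : ∀ j, StrictMono (X j) := fun j => ((Z j).orderEmbOfFin (hZ j)).strictMono
  have hK : IsCompact (Set.pi univ (fun _ : Fin m => Icc (0:ℝ) 1)) :=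
    isCompact_univ_pi (fun _ => isCompact_Icc)
  obtain ⟨x, hxI, φ, hφ, hlim⟩ := hK.tendsto_subseq (x := X)
    (fun j i _ => ⟨(hX j i).1.le, (hX j i).2.1.le⟩)
  have hε' := hε.comp hφ.tendsto_atTop
  have hli : ∀ i, Filter.Tendsto (fun j => X (φ j) i) Filter.atTop (nhds (x i)) :=
    fun i => (tendsto_pi_nhds.1 hlim) i
  have hxz : ∀ i, z (x i) = 0 := fun i =>
    zero_lim E'.S.d0.cont E.S.d0.cont hε' (fun j => ⟨(hX (φ j) i).1.le, (hX (φ j) i).2.1.le⟩)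
      (hli i) (fun j => (hX (φ j) i).2.2)
  have hdd : ∀ e : ℝ, Der (fun t => z t + e * y t) (fun t => z1 t + e * y1 t) :=
    fun e => E'.S.d0.add (E.S.d0.smul e)
  have hdd1 : ∀ e : ℝ, Der (fun t => z1 t + e * y1 t) (fun t => v t / p t + e * (w t / p t)) :=
    fun e => E'.S.d1.add (E.S.d1.smul e)
  have hx1 : ∀ i, x i < 1 := by
    intro i
    apply lt_of_le_of_ne (hxI i trivial).2
    intro h1
    have := hxz i
    rw [h1] at this
    exact E'.ne1 H this
  have hx0 : ∀ i, 0 < x i := by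
    intro i
    apply lt_of_le_of_ne (hxI i trivial).1
    intro h1
    have : ∀ j, ∃ t, 0 < t ∧ t < X (φ j) i ∧ v t + ε (φ j) * w t = 0 := by
      intro j
      obtain ⟨t, t1, t2, t3⟩ := (hdd (ε (φ j))).rolle le_rfl (hX (φ j) i).1 (hX (φ j) i).2.1.le
        (by simp only [E.S.b0, E'.S.b0]; rw [(hX (φ j) i).2.2]; simp)
      obtain ⟨t', t1', t2', t3'⟩ := (hdd1 (ε (φ j))).rolle le_rfl t1
        (t2.le.trans (hX (φ j) i).2.1.le)
        (by simp only [E.S.b1, E'.S.b1]; rw [t3]; simp)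
      refine ⟨t', t1', t2'.trans t2, ?_⟩
      have hp := H.pp t' ⟨t1'.le, (t2'.trans (t2.trans (hX (φ j) i).2.1)).le⟩
      field_simp at t3'
      linarith
    choose T T1 T2 T3 using this
    refine E'.ne0 H (zero_lim E'.S.d2.cont E.S.d2.cont hε' (x := T) 
      (fun j => ⟨(T1 j).le, ((T2 j).trans (hX (φ j) i).2.1).le⟩) ?_ T3)
    have := hli i
    rw [← h1] at this
    exact squeeze_zero (fun j => (T1 j).le) (fun j => (T2 j).le) this
  have hle : Monotone x := by
    intro i i' hi
    exact le_of_tendsto_of_tendsto' (hli i) (hli i') (fun j => (hmono (φ j)).monotone hi)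
  have hinj : ∀ i i', i < i' → x i ≠ x i' := by
    intro i i' hi he
    have : ∀ j, ∃ t, X (φ j) i < t ∧ t < X (φ j) i' ∧ z1 t + ε (φ j) * y1 t = 0 := by
      intro j
      exact (hdd (ε (φ j))).rolle (hX (φ j) i).1.le (hmono (φ j) hi) (hX (φ j) i').2.1.le
        (by rw [(hX (φ j) i).2.2, (hX (φ j) i').2.2])
    choose T T1 T2 T3 using this
    refine E'.simple H (hx0 i) (hx1 i) (hxz i) (zero_lim E'.S.d1.cont E.S.d1.cont hε' (x := T) 
      (fun j => ⟨(hX (φ j) i).1.le.trans (T1 j).le, ((T2 j).trans (hX (φ j) i').2.1).le⟩) ?_ T3)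
    exact tendsto_of_tendsto_of_tendsto_of_le_of_le (hli i) (he ▸ hli i') (fun j => (T1 j).le)
      (fun j => (T2 j).le)
  have hinj' : Function.Injective x := by
    intro i i' he
    rcases lt_trichotomy i i' with h | h | h
    · exact absurd he (hinj _ _ h)
    · exact h
    · exact absurd he.symm (hinj _ _ h)
  refine ⟨Finset.univ.map ⟨x, hinj'⟩, by simp, ?_⟩
  intro t ht
  obtain ⟨i, -, rfl⟩ := Finset.mem_map.1 ht
  exact ⟨hx0 i, hx1 i, hxz i⟩

lemma Sys.comb {f g : ℝ → ℝ} (S : Sys p r α y y1 w w1 f) (S' : Sys p r α z z1 v v1 g)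
    (a b : ℝ) : Sys p r α (fun x => a * y x + b * z x) (fun x => a * y1 x + b * z1 x)
      (fun x => a * w x + b * v x) (fun x => a * w1 x + b * v1 x) (fun x => a * f x + b * g x) where
  d0 := (S.d0.smul a).add (S'.d0.smul b)
  d1 := ((S.d1.smul a).add (S'.d1.smul b)).congr (fun _ _ => rfl) (fun x _ => by ring)
  d2 := (S.d2.smul a).add (S'.d2.smul b)
  d3 := ((S.d3.smul a).add (S'.d3.smul b)).congr (fun _ _ => rfl) (fun x _ => by ring)
  b0 := by simp [S.b0, S'.b0]
  b1 := by simp [S.b1, S'.b1]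
  b2 := by simp [S.b2, S'.b2]
  b3 := by simp only [S.b3, S'.b3]; ring
  fc := (continuousOn_const.mul S.fc).add (continuousOn_const.mul S'.fc)

lemma Sys.congr {u u1 f f' : ℝ → ℝ} (S : Sys p r α u u1 w w1 f)
    (h : ∀ x ∈ Icc (0:ℝ) 1, f' x = f x) : Sys p r α u u1 w w1 f' where
  d0 := S.d0
  d1 := S.d1
  d2 := S.d2
  d3 := S.d3.congr (fun _ _ => rfl) (fun x hx => by rw [h x hx])
  b0 := S.b0
  b1 := S.b1
  b2 := S.b2
  b3 := by rw [S.b3, h 1 ⟨zero_le_one, le_rfl⟩]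
  fc := S.fc.congr h

lemma Sys.congr' {u u' u1 f : ℝ → ℝ} (S : Sys p r α u u1 w w1 f)
    (h : ∀ x ∈ Icc (0:ℝ) 1, u' x = u x) : Sys p r α u' u1 w w1 f where
  d0 := S.d0.congr h (fun _ _ => rfl)
  d1 := S.d1
  d2 := S.d2
  d3 := S.d3
  b0 := by rw [h 0 ⟨le_rfl, zero_le_one⟩, S.b0]
  b1 := S.b1
  b2 := S.b2
  b3 := S.b3
  fc := S.fc

/-- simplicity of eigenvalues -/
lemma Eg.prop (H : Hyp p r α) (E : Eg p r α lam y y1 w w1) (E' : Eg p r α lam z z1 v v1) :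
    ∀ x ∈ Icc (0:ℝ) 1, z 1 * y x = y 1 * z x := by
  by_contra! hc
  obtain ⟨x, hx, hne⟩ := hc
  have E2 : Eg p r α lam (fun x => z 1 * y x + -(y 1) * z x) _ _ _ :=
    ⟨(E.S.comb E'.S (z 1) (-(y 1))).congr (fun x _ => by ring), E.lp,
      ⟨x, hx, fun h => hne (by linarith)⟩⟩
  exact E2.ne1 H (by ring)

lemma Eg.comb_nondeg (H : Hyp p r α) (E : Eg p r α lam y y1 w w1) (E' : Eg p r α mu z z1 v v1)
    (hlt : lam < mu) (e : ℝ) : Nondeg (fun x => 1 * y x + e * z x) := by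
  intro a b ha hab hb
  by_contra! hc
  have S := E.S.comb E'.S 1 e
  have z1 := S.d0.zero ha hb hc
  have z2 := S.d1.zero ha hb z1
  have z3 := S.d2.zero ha hb (fun t h1 h2 => by
    have := z2 t h1 h2
    rcases div_eq_zero_iff.1 this with h | h
    · exact h
    · exact absurd h (H.pp t ⟨ha.trans h1.le, h2.le.trans hb⟩).ne')
  have z4 := S.d3.zero ha hb z3
  obtain ⟨t, h1, h2, h3⟩ := E.nondeg H a b ha hab hb
  have hh := z4 t h1 h2
  have hh' := hc t h1 h2
  rcases mul_eq_zero.1 hh with h | h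
  · exact absurd h (H.rp t ⟨ha.trans h1.le, h2.le.trans hb⟩).ne'
  · have : (mu - lam) * y t = 0 := by linear_combination mu * hh' - h
    rcases mul_eq_zero.1 this with h | h
    · linarith
    · exact h3 h

/-- strict monotonicity of the number of sign changes -/
lemma Eg.mono (H : Hyp p r α) (E : Eg p r α lam y y1 w w1) (E' : Eg p r α mu z z1 v v1)
    (hlt : lam < mu) {m : ℕ} {s : ℝ} (hs : s ≠ 0) (h : Alt y (m+1) s 0 1) :
    ∃ t, t ≠ 0 ∧ Alt z (m+2) t 0 1 := by
  set q := lam / mu with hq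
  have hl := E.lp
  have hm := E'.lp
  have hq0 : 0 < q := by positivity
  have hq1 : q < 1 := (div_lt_one hm).2 hlt
  let F : ℝ → ℝ → ℝ := fun e x => 1 * y x + e * z x
  have hF : ∀ e, ∃ a b c, Sys p r α (F (e * q)) a b c (fun x => lam * F e x) := fun e =>
    ⟨_, _, _, (E.S.comb E'.S 1 (e * q)).congr (fun x _ => by
      simp only [F]; rw [hq]; field_simp)⟩
  have hN : ∀ e, Nondeg (fun x => lam * F e x) := fun e =>
    (E.comb_nondeg H E' hlt e).smul hl.ne'
  have hstep : ∀ e k, Alt (F (e * q)) (k+1) s 0 1 → Alt (F e) (k+1) s 0 1 := by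
    intro e k hk
    obtain ⟨a, b, c, S⟩ := hF e
    exact (S.KL H (hN e) hs hk.weak).of_smul hl
  have hiter : ∀ (j : ℕ) e k, Alt (F (e * q ^ j)) (k+1) s 0 1 → Alt (F e) (k+1) s 0 1 := by
    intro j
    induction j with
    | zero => intro e k hk; simpa using hk
    | succ j ih =>
      intro e k hk
      apply ih e k
      apply hstep
      rwa [mul_assoc, ← pow_succ]
  set c := -(y 1) / z 1 with hc
  have hz1 := E'.ne1 H
  have hy1 := E.ne1 H
  have hc0 : c ≠ 0 := div_ne_zero (neg_ne_zero.2 hy1) hz1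
  have hqt : Filter.Tendsto (fun j : ℕ => q ^ j) Filter.atTop (nhds 0) :=
    tendsto_pow_atTop_nhds_zero_of_lt_one hq0.le hq1
  have A0 : Alt (F c) (m+1) s 0 1 := by
    have ev := h.eventually (l := Filter.atTop) (G := fun j : ℕ => F (c * q ^ j)) (by
      intro x _ _
      have := ((hqt.const_mul c).mul_const (z x)).const_add (1 * y x)
      simpa [F] using this)
    obtain ⟨j, hj⟩ := ev.exists
    exact hiter j c m hj
  have A1 : Alt (F (c * q⁻¹)) (m+2) s 0 1 := by
    obtain ⟨a, b, d, S⟩ := hF (c * q⁻¹)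
    have e : c * q⁻¹ * q = c := by field_simp
    rw [e] at S
    exact (S.KL1 H (hN _) hs (by simp only [F]; rw [hc]; field_simp; ring) A0.weak).of_smul hl
  have A2 : ∀ j : ℕ, Alt (F (c * q⁻¹ * (q ^ j)⁻¹)) (m+2) s 0 1 := by
    intro j
    apply hiter j
    have : c * q⁻¹ * (q ^ j)⁻¹ * q ^ j = c * q⁻¹ := by
      have := (pow_pos hq0 j).ne'
      field_simp
    rwa [this]
  have U : ∃ Z : Finset ℝ, Z.card = m + 1 ∧ ∀ t ∈ Z, 0 < t ∧ t < 1 ∧ z t = 0 := by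
    refine E.usc H E' (ε := fun j => c⁻¹ * q * q ^ j) (by simpa using hqt.const_mul (c⁻¹ * q)) ?_
    intro j
    obtain ⟨Z, hZ, hz⟩ := (A2 j).zeros
      ((continuousOn_const.mul E.S.d0.cont).add (continuousOn_const.mul E'.S.d0.cont))
    refine ⟨Z, hZ, fun t ht => ⟨(hz t ht).1, (hz t ht).2.1, ?_⟩⟩
    have : 1 * y t + c * q⁻¹ * (q ^ j)⁻¹ * z t = 0 := (hz t ht).2.2
    have hj := (pow_pos hq0 j).ne'
    field_simp at this ⊢
    linarith
  obtain ⟨Z, hZ, hz⟩ := U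
  exact E'.zeros_alt H Z hZ hz

lemma Eg.card_lt (H : Hyp p r α) (E : Eg p r α lam y y1 w w1) (E' : Eg p r α mu z z1 v v1)
    (hlt : lam < mu) :
    {x ∈ Ioo (0:ℝ) 1 | y x = 0}.ncard < {x ∈ Ioo (0:ℝ) 1 | z x = 0}.ncard := by
  obtain ⟨s, hs, h⟩ := E.alt_card H
  obtain ⟨t, ht, h'⟩ := E.mono H E' hlt hs h
  exact E'.le_card H h'

end
end Osc

namespace Osc

/-- the bilinear form -/
noncomputable def B (r : ℝ → ℝ) (α : ℝ) (f g : ℝ → ℝ) : ℝ :=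
  (∫ x in (0:ℝ)..1, r x * f x * g x) + α * f 1 * g 1

abbrev CO (f : ℝ → ℝ) : Prop := ContinuousOn f (Icc 0 1)

lemma CO.ii {f : ℝ → ℝ} (h : CO f) {a b : ℝ} (ha : 0 ≤ a) (hab : a ≤ b) (hb : b ≤ 1) :
    IntervalIntegrable f MeasureTheory.volume a b :=
  (h.mono (Icc_subset_Icc ha hb)).intervalIntegrable_of_Icc hab

lemma CO.ii' {f : ℝ → ℝ} (h : CO f) : IntervalIntegrable f MeasureTheory.volume 0 1 :=
  h.ii le_rfl zero_le_one le_rfl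

lemma Der.ftc {g g' : ℝ → ℝ} (h : Der g g') (hc : CO g') {a b : ℝ} (ha : 0 ≤ a) (hab : a ≤ b)
    (hb : b ≤ 1) : ∫ x in a..b, g' x = g b - g a :=
  intervalIntegral.integral_eq_sub_of_hasDerivAt_of_le hab (h.cont.mono (Icc_subset_Icc ha hb))
    (fun _ hx => h.at (ha.trans_lt hx.1) (hx.2.trans_le hb)) (hc.ii ha hab hb)

lemma Der.lip {g g' : ℝ → ℝ} (h : Der g g') {M : ℝ} (hM : ∀ x ∈ Icc (0:ℝ) 1, |g' x| ≤ M)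
    {x y : ℝ} (hx : x ∈ Icc (0:ℝ) 1) (hy : y ∈ Icc (0:ℝ) 1) : |g x - g y| ≤ M * |x - y| :=
  (convex_Icc (0:ℝ) 1).norm_image_sub_le_of_norm_hasDerivWithin_le h hM hy hx

section
variable {p r : ℝ → ℝ} {α : ℝ}

lemma B_comm (f g : ℝ → ℝ) : B r α f g = B r α g f := by
  unfold B
  congr 1
  · congr 1; ext x; ring
  · ring

lemma B_congr {f g f' g' : ℝ → ℝ} (hf : ∀ x ∈ Icc (0:ℝ) 1, f x = f' x)
    (hg : ∀ x ∈ Icc (0:ℝ) 1, g x = g' x) : B r α f g = B r α f' g' := by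
  unfold B
  have i1 : (1:ℝ) ∈ Icc (0:ℝ) 1 := ⟨zero_le_one, le_rfl⟩
  rw [hf 1 i1, hg 1 i1]
  congr 1
  apply intervalIntegral.integral_congr
  intro x hx
  rw [uIcc_of_le zero_le_one] at hx
  simp only [hf x hx, hg x hx]

lemma B_left (H : Hyp p r α) {f g h : ℝ → ℝ} (hf : CO f) (hg : CO g) (hh : CO h) (a b : ℝ) :
    B r α (fun x => a * f x + b * g x) h = a * B r α f h + b * B r α g h := by
  unfold B
  have e : ∀ x, r x * (a * f x + b * g x) * h x = a * (r x * f x * h x) + b * (r x * g x * h x) :=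
    fun x => by ring
  simp only [e]
  rw [intervalIntegral.integral_add, intervalIntegral.integral_const_mul,
    intervalIntegral.integral_const_mul]
  · ring
  · exact CO.ii' (continuousOn_const.mul ((H.rc.mul hf).mul hh))
  · exact CO.ii' (continuousOn_const.mul ((H.rc.mul hg).mul hh))

lemma B_right (H : Hyp p r α) {f g h : ℝ → ℝ} (hf : CO f) (hg : CO g) (hh : CO h) (a b : ℝ) :
    B r α h (fun x => a * f x + b * g x) = a * B r α h f + b * B r α h g := by
  rw [B_comm, B_left H hf hg hh, B_comm f, B_comm g]

lemma CO.comb {f g : ℝ → ℝ} (hf : CO f) (hg : CO g) (a b : ℝ) :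
    CO (fun x => a * f x + b * g x) :=
  (continuousOn_const.mul hf).add (continuousOn_const.mul hg)

lemma B_quad (H : Hyp p r α) {f g : ℝ → ℝ} (hf : CO f) (hg : CO g) (a b : ℝ) :
    B r α (fun x => a * f x + b * g x) (fun x => a * f x + b * g x) =
      a^2 * B r α f f + 2 * a * b * B r α f g + b^2 * B r α g g := by
  rw [B_left H hf hg (hf.comb hg a b), B_right H hf hg hf, B_right H hf hg hg, B_comm g f]
  ring

lemma B_nonneg (H : Hyp p r α) (f : ℝ → ℝ) : 0 ≤ B r α f f := by
  unfold B
  apply add_nonneg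
  · apply intervalIntegral.integral_nonneg zero_le_one
    intro x hx
    rw [mul_assoc]
    exact mul_nonneg (H.rp x hx).le (mul_self_nonneg _)
  · rw [mul_assoc]
    exact mul_nonneg H.ap (mul_self_nonneg _)

lemma B_pos (H : Hyp p r α) {f : ℝ → ℝ} (hf : CO f) (h : ∃ x ∈ Icc (0:ℝ) 1, f x ≠ 0) :
    0 < B r α f f := by
  unfold B
  apply add_pos_of_pos_of_nonneg
  · apply intervalIntegral.integral_pos zero_lt_one ((H.rc.mul hf).mul hf)
    · intro x hx
      rw [mul_assoc]
      exact mul_nonneg (H.rp x ⟨hx.1.le, hx.2⟩).le (mul_self_nonneg _)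
    · obtain ⟨x, hx, hne⟩ := h
      refine ⟨x, hx, ?_⟩
      rw [mul_assoc]
      exact mul_pos (H.rp x hx) (mul_self_pos.2 hne)
  · rw [mul_assoc]
    exact mul_nonneg H.ap (mul_self_nonneg _)

lemma B_zero (H : Hyp p r α) {f : ℝ → ℝ} (hf : CO f) (h : B r α f f ≤ 0) :
    ∀ x ∈ Icc (0:ℝ) 1, f x = 0 := by
  by_contra! hc
  exact absurd (B_pos H hf hc) (not_lt.2 h)

lemma B_cs (H : Hyp p r α) {f g : ℝ → ℝ} (hf : CO f) (hg : CO g) :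
    B r α f g ^ 2 ≤ B r α f f * B r α g g := by
  have := discrim_le_zero (a := B r α g g) (b := 2 * B r α f g) (c := B r α f f) (fun t => by
    have := B_nonneg H (fun x => 1 * f x + t * g x)
    rw [B_quad H hf hg] at this
    linarith)
  unfold discrim at this
  linarith

lemma B_sum3 (H : Hyp p r α) {f g h : ℝ → ℝ} (hf : CO f) (hg : CO g) (hh : CO h) :
    B r α (fun x => f x + g x + h x) (fun x => f x + g x + h x) ≤
      3 * (B r α f f + B r α g g + B r α h h) := by
  unfold B
  have hi : ∀ {k : ℝ → ℝ}, CO k → CO (fun x => r x * k x * k x) := fun hk => (H.rc.mul hk).mul hk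
  have e : (∫ x in (0:ℝ)..1, r x * (f x + g x + h x) * (f x + g x + h x)) ≤
      ∫ x in (0:ℝ)..1, 3 * ((r x * f x * f x + r x * g x * g x) + r x * h x * h x) := by
    have q0 : CO (fun x => f x + g x + h x) := (hf.add hg).add hh
    have q1 : CO (fun x => 3 * ((r x * f x * f x + r x * g x * g x) + r x * h x * h x)) :=
      continuousOn_const.mul (((hi hf).add (hi hg)).add (hi hh))
    apply intervalIntegral.integral_mono_on zero_le_one (hi q0).ii' q1.ii'
    intro x hx
    have := mul_nonneg (H.rp x hx).le (sq_nonneg (f x - g x))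
    have := mul_nonneg (H.rp x hx).le (sq_nonneg (f x - h x))
    have := mul_nonneg (H.rp x hx).le (sq_nonneg (g x - h x))
    nlinarith
  have q2 : CO (fun x => r x * f x * f x + r x * g x * g x) := (hi hf).add (hi hg)
  rw [intervalIntegral.integral_const_mul, intervalIntegral.integral_add
    q2.ii' (hi hh).ii', intervalIntegral.integral_add (hi hf).ii'
    (hi hg).ii'] at e
  have := mul_nonneg H.ap (sq_nonneg (f 1 - g 1))
  have := mul_nonneg H.ap (sq_nonneg (f 1 - h 1))
  have := mul_nonneg H.ap (sq_nonneg (g 1 - h 1))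
  nlinarith

lemma B_le (H : Hyp p r α) {f : ℝ → ℝ} (hf : CO f) {K : ℝ} (hK : ∀ x ∈ Icc (0:ℝ) 1, |f x| ≤ K) :
    B r α f f ≤ B r α (fun _ => 1) (fun _ => 1) * K^2 := by
  have hs : ∀ x ∈ Icc (0:ℝ) 1, f x ^ 2 ≤ K ^ 2 := fun x hx =>
    sq_le_sq' (by have := abs_le.1 (hK x hx); linarith) (abs_le.1 (hK x hx)).2
  unfold B
  have e : (∫ x in (0:ℝ)..1, r x * f x * f x) ≤ ∫ x in (0:ℝ)..1, (r x * 1 * 1) * K^2 := by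
    have q0 : CO (fun x => r x * f x * f x) := (H.rc.mul hf).mul hf
    have q1 : CO (fun x => (r x * 1 * 1) * K^2) :=
      ((H.rc.mul continuousOn_const).mul continuousOn_const).mul continuousOn_const
    apply intervalIntegral.integral_mono_on zero_le_one q0.ii' q1.ii'
    intro x hx
    have := mul_le_mul_of_nonneg_left (hs x hx) (H.rp x hx).le
    nlinarith
  rw [intervalIntegral.integral_mul_const] at e
  have := mul_le_mul_of_nonneg_left (hs 1 ⟨zero_le_one, le_rfl⟩) H.ap
  nlinarith

/-- `u = T f`. -/
def Rel (p r : ℝ → ℝ) (α : ℝ) (u f : ℝ → ℝ) : Prop := ∃ u1 w w1, Sys p r α u u1 w w1 f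

lemma Rel.co {u f : ℝ → ℝ} (h : Rel p r α u f) : CO u := by
  obtain ⟨_, _, _, S⟩ := h; exact S.d0.cont

lemma Rel.comb {u f v g : ℝ → ℝ} (h : Rel p r α u f) (h' : Rel p r α v g) (a b : ℝ) :
    Rel p r α (fun x => a * u x + b * v x) (fun x => a * f x + b * g x) := by
  obtain ⟨_, _, _, S⟩ := h
  obtain ⟨_, _, _, S'⟩ := h'
  exact ⟨_, _, _, S.comb S' a b⟩

lemma Rel.symm (H : Hyp p r α) {u f v g : ℝ → ℝ} (h : Rel p r α u f) (h' : Rel p r α v g) :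
    B r α f v = B r α u g := by
  obtain ⟨u1, w, w1, S⟩ := h
  obtain ⟨v1, z, z1, S'⟩ := h'
  have D : Der (fun x => (w1 x * v x + (-1) * (w x * v1 x)) + (u1 x * z x + (-1) * (u x * z1 x)))
      (fun x => r x * f x * v x + (-1) * (r x * u x * g x)) := by
    refine (((S.d3.mul S'.d0).add ((S.d2.mul S'.d1).smul (-1))).add
      ((S.d1.mul S'.d2).add ((S.d0.mul S'.d3).smul (-1)))).congr (fun _ _ => rfl) (fun x _ => ?_)
    ring
  have c1 : CO (fun x => r x * f x * v x) := (H.rc.mul S.fc).mul S'.d0.cont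
  have c2 : CO (fun x => r x * u x * g x) := (H.rc.mul S.d0.cont).mul S'.fc
  have c3 : CO (fun x => (-1) * (r x * u x * g x)) := continuousOn_const.mul c2
  have := D.ftc (c1.add c3) le_rfl zero_le_one le_rfl
  rw [intervalIntegral.integral_add c1.ii' c3.ii',
    intervalIntegral.integral_const_mul] at this
  simp only [S.b0, S.b1, S.b2, S.b3, S'.b0, S'.b1, S'.b2, S'.b3] at this
  unfold B
  linear_combination this

lemma Rel.pos (H : Hyp p r α) {u f : ℝ → ℝ} (h : Rel p r α u f) : 0 ≤ B r α f u := by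
  obtain ⟨u1, w, w1, S⟩ := h
  have D : Der (fun x => w1 x * u x + (-1) * (w x * u1 x))
      (fun x => r x * f x * u x + (-1) * (w x * w x / p x)) := by
    refine ((S.d3.mul S.d0).add ((S.d2.mul S.d1).smul (-1))).congr (fun _ _ => rfl) (fun x _ => ?_)
    ring
  have c1 : CO (fun x => r x * f x * u x) := (H.rc.mul S.fc).mul S.d0.cont
  have c2 : CO (fun x => w x * w x / p x) :=
    (S.d2.cont.mul S.d2.cont).div H.pc (fun x hx => (H.pp x hx).ne')
  have c3 : CO (fun x => (-1) * (w x * w x / p x)) := continuousOn_const.mul c2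
  have := D.ftc (c1.add c3) le_rfl zero_le_one le_rfl
  rw [intervalIntegral.integral_add c1.ii' c3.ii',
    intervalIntegral.integral_const_mul] at this
  simp only [S.b0, S.b1, S.b2, S.b3] at this
  have n : 0 ≤ ∫ x in (0:ℝ)..1, w x * w x / p x := by
    apply intervalIntegral.integral_nonneg zero_le_one
    intro x hx
    exact div_nonneg (mul_self_nonneg _) (H.pp x hx).le
  unfold B
  linarith

lemma Rel.bound (H : Hyp p r α) : ∃ C, 0 ≤ C ∧ ∀ u f, Rel p r α u f →
    (∀ x ∈ Icc (0:ℝ) 1, |u x| ≤ C * Real.sqrt (B r α f f)) ∧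
    (∀ x ∈ Icc (0:ℝ) 1, ∀ y ∈ Icc (0:ℝ) 1, |u x - u y| ≤ C * Real.sqrt (B r α f f) * |x - y|) := by
  obtain ⟨C1, hC1⟩ := isCompact_Icc.exists_bound_of_continuousOn
    (H.pc.inv₀ (fun x hx => (H.pp x hx).ne'))
  have i0 : (0:ℝ) ∈ Icc (0:ℝ) 1 := ⟨le_rfl, zero_le_one⟩
  have i1 : (1:ℝ) ∈ Icc (0:ℝ) 1 := ⟨zero_le_one, le_rfl⟩
  have hC1' : 0 ≤ C1 := (norm_nonneg _).trans (hC1 0 i0)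
  refine ⟨C1 * Real.sqrt (B r α (fun _ => 1) (fun _ => 1)), by positivity, ?_⟩
  rintro u f ⟨u1, w, w1, S⟩
  set M := Real.sqrt (B r α (fun _ => 1) (fun _ => 1)) * Real.sqrt (B r α f f) with hMdef
  have hM : 0 ≤ M := by positivity
  have habs : CO (fun x => |f x|) := S.fc.abs
  have hB : B r α (fun _ => 1) (fun x => |f x|) ≤ M := by
    rw [hMdef, ← Real.sqrt_mul (B_nonneg H _)]
    apply Real.le_sqrt_of_sq_le
    have e : B r α f f = B r α (fun x => |f x|) (fun x => |f x|) := by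
      unfold B
      simp only [mul_assoc, abs_mul_abs_self]
    rw [e]
    exact B_cs H continuousOn_const habs
  have crf : CO (fun x => r x * f x) := H.rc.mul S.fc
  have cra : CO (fun x => r x * 1 * |f x|) := (H.rc.mul continuousOn_const).mul habs
  have hw1 : ∀ x ∈ Icc (0:ℝ) 1, |w1 x| ≤ M := by
    intro x hx
    refine le_trans ?_ hB
    have e1 := S.d3.ftc crf hx.1 hx.2 le_rfl
    have e2 : |∫ t in x..1, r t * f t| ≤ ∫ t in x..1, r t * 1 * |f t| := by
      refine (intervalIntegral.abs_integral_le_integral_abs hx.2).trans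
        (le_of_eq (intervalIntegral.integral_congr ?_))
      intro t ht
      rw [uIcc_of_le hx.2] at ht
      have := H.rp t ⟨hx.1.trans ht.1, ht.2⟩
      simp only [abs_mul, abs_of_pos this, mul_one]
    have e3 : ∫ t in x..1, r t * 1 * |f t| ≤ ∫ t in (0:ℝ)..1, r t * 1 * |f t| := by
      have a := intervalIntegral.integral_add_adjacent_intervals
        (cra.ii le_rfl hx.1 hx.2) (cra.ii hx.1 hx.2 le_rfl)
      have b : 0 ≤ ∫ t in (0:ℝ)..x, r t * 1 * |f t| := by
        apply intervalIntegral.integral_nonneg hx.1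
        intro t ht
        have := H.rp t ⟨ht.1, ht.2.trans hx.2⟩
        positivity
      linarith
    have e4 : w1 x = -(α * f 1) - ∫ t in x..1, r t * f t := by rw [e1, S.b3]; ring
    unfold B
    have e5 : |α * f 1| = α * |f 1| := by rw [abs_mul, abs_of_nonneg H.ap]
    rw [e4]
    have e6 := abs_sub (-(α * f 1)) (∫ t in x..1, r t * f t)
    rw [abs_neg, e5] at e6
    linarith
  have hw : ∀ x ∈ Icc (0:ℝ) 1, |w x| ≤ M := by
    obtain ⟨t, t1, t2, t3⟩ := S.d1.rolle le_rfl zero_lt_one le_rfl (by rw [S.b1, S.b2])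
    have ht : t ∈ Icc (0:ℝ) 1 := ⟨t1.le, t2.le⟩
    have h0 : w t = 0 := by
      rcases div_eq_zero_iff.1 t3 with h | h
      · exact h
      · exact absurd h (H.pp t ht).ne'
    intro x hx
    have := S.d2.lip hw1 hx ht
    rw [h0, sub_zero] at this
    have h2 : |x - t| ≤ 1 := abs_le.2 ⟨by linarith [hx.1], by linarith [hx.2]⟩
    nlinarith
  have hwp : ∀ x ∈ Icc (0:ℝ) 1, |w x / p x| ≤ C1 * M := by
    intro x hx
    rw [div_eq_mul_inv, abs_mul, mul_comm]
    exact mul_le_mul (hC1 x hx) (hw x hx) (abs_nonneg _) hC1'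
  have hz : ∀ {g g' : ℝ → ℝ}, Der g g' → g 0 = 0 → (∀ x ∈ Icc (0:ℝ) 1, |g' x| ≤ C1 * M) →
      ∀ x ∈ Icc (0:ℝ) 1, |g x| ≤ C1 * M := by
    intro g g' hd h0 hb x hx
    have := hd.lip hb hx i0
    rw [h0, sub_zero, sub_zero, abs_of_nonneg hx.1] at this
    have h2 := hx.2
    have h3 := mul_nonneg hC1' hM
    nlinarith
  have hu1 := hz S.d1 S.b1 hwp
  have hu := hz S.d0 S.b0 hu1
  rw [mul_assoc]
  exact ⟨hu, fun x hx y hy => S.d0.lip hu1 hx hy⟩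

lemma Rel.exist (H : Hyp p r α) (f : ℝ → ℝ) (hf : CO f) : ∃ u, Rel p r α u f := by
  have ext : ∀ g : ℝ → ℝ, CO g → ∃ G : ℝ → ℝ, Continuous G ∧ ∀ x ∈ Icc (0:ℝ) 1, G x = g x := by
    intro g hg
    refine ⟨IccExtend zero_le_one ((Icc (0:ℝ) 1).domRestrict g), ?_, ?_⟩
    · exact (continuousOn_iff_continuous_domRestrict.1 hg).Icc_extend'
    · intro x hx
      rw [IccExtend_of_mem _ _ hx]; rfl
  obtain ⟨Q, hQ, hQe⟩ := ext (fun x => (p x)⁻¹) (H.pc.inv₀ (fun x hx => (H.pp x hx).ne'))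
  obtain ⟨R, hR, hRe⟩ := ext (fun x => r x * f x) (H.rc.mul hf)
  have prim : ∀ g : ℝ → ℝ, Continuous g → Der (fun x => ∫ t in (0:ℝ)..x, g t) g ∧
      Continuous (fun x => ∫ t in (0:ℝ)..x, g t) := by
    intro g hg
    have : ∀ x, HasDerivAt (fun x => ∫ t in (0:ℝ)..x, g t) (g x) x := fun x =>
      (hg.integral_hasStrictDerivAt 0 x).hasDerivAt
    exact ⟨fun x _ => (this x).hasDerivWithinAt,
      continuous_iff_continuousAt.2 fun x => (this x).continuousAt⟩
  have cder : ∀ c : ℝ, Der (fun _ => c) (fun _ => 0) := fun c x _ => hasDerivWithinAt_const x _ c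
  have pc : ∀ (c : ℝ) (g : ℝ → ℝ), Continuous g → Der (fun x => c + ∫ t in (0:ℝ)..x, g t) g ∧
      Continuous (fun x => c + ∫ t in (0:ℝ)..x, g t) := by
    intro c g hg
    obtain ⟨h1, h2⟩ := prim g hg
    exact ⟨((cder c).add h1).congr (fun _ _ => rfl) (fun x _ => by ring), continuous_const.add h2⟩
  set K := -(α * f 1) - ∫ t in (0:ℝ)..1, R t with hK
  obtain ⟨d3, c3⟩ := pc K R hR
  set w1 : ℝ → ℝ := fun x => K + ∫ t in (0:ℝ)..x, R t with hw1
  obtain ⟨-, ca⟩ := prim w1 c3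
  set I := ∫ t in (0:ℝ)..1, Q t with hI
  have hIpos : 0 < I := by
    apply intervalIntegral.integral_pos zero_lt_one hQ.continuousOn
    · intro x hx
      have hx' : x ∈ Icc (0:ℝ) 1 := ⟨hx.1.le, hx.2⟩
      rw [hQe x hx']
      exact (inv_pos.2 (H.pp x hx')).le
    · refine ⟨0, ⟨le_rfl, zero_le_one⟩, ?_⟩
      rw [hQe 0 ⟨le_rfl, zero_le_one⟩]
      exact inv_pos.2 (H.pp 0 ⟨le_rfl, zero_le_one⟩)
  set J := ∫ t in (0:ℝ)..1, (∫ s in (0:ℝ)..t, w1 s) * Q t with hJ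
  obtain ⟨d2, c2⟩ := pc (-J / I) w1 c3
  set w : ℝ → ℝ := fun x => -J / I + ∫ t in (0:ℝ)..x, w1 t with hw
  obtain ⟨d1, c1⟩ := prim (fun x => w x * Q x) (c2.mul hQ)
  set u1 : ℝ → ℝ := fun x => ∫ t in (0:ℝ)..x, w t * Q t with hu1
  obtain ⟨d0, c0⟩ := prim u1 c1
  refine ⟨fun x => ∫ t in (0:ℝ)..x, u1 t, u1, w, w1, ?_⟩
  exact
  { d0 := d0
    d1 := d1.congr (fun _ _ => rfl) (fun x hx => by rw [hQe x hx]; rfl)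
    d2 := d2
    d3 := d3.congr (fun _ _ => rfl) (fun x hx => by rw [hRe x hx])
    b0 := by simp
    b1 := by simp [hu1]
    b2 := by
      simp only [hu1, hw, add_mul]
      rw [intervalIntegral.integral_add, intervalIntegral.integral_const_mul, ← hI, ← hJ]
      · field_simp; ring
      · exact (continuous_const.mul hQ).intervalIntegrable _ _
      · exact (ca.mul hQ).intervalIntegrable _ _
    b3 := by simp only [hw1, hK]; ring
    fc := hf }

lemma arzela {G : ℕ → ℝ → ℝ} {M : ℝ} (hb : ∀ j, ∀ x ∈ Icc (0:ℝ) 1, |G j x| ≤ M)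
    (hl : ∀ j, ∀ x ∈ Icc (0:ℝ) 1, ∀ y ∈ Icc (0:ℝ) 1, |G j x - G j y| ≤ M * |x - y|) :
    ∃ (h : ℝ → ℝ) (φ : ℕ → ℕ), StrictMono φ ∧ CO h ∧
      ∀ ε > 0, ∀ᶠ j in Filter.atTop, ∀ x ∈ Icc (0:ℝ) 1, |G (φ j) x - h x| ≤ ε := by
  have hM : 0 ≤ M := (abs_nonneg _).trans (hb 0 0 ⟨le_rfl, zero_le_one⟩)
  have hL : ∀ j, LipschitzWith M.toNNReal (fun x : Icc (0:ℝ) 1 => G j x) := fun j =>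
    LipschitzWith.of_dist_le_mul fun x y => by
      rw [Real.coe_toNNReal _ hM]
      exact hl j x x.2 y y.2
  let g : ℕ → BoundedContinuousFunction (Icc (0:ℝ) 1) ℝ := fun j =>
    BoundedContinuousFunction.mkOfCompact ⟨fun x : Icc (0:ℝ) 1 => G j x, (hL j).continuous⟩
  have hcomp : IsCompact (closure (range g)) := by
    apply BoundedContinuousFunction.arzela_ascoli (Icc (-M) M) isCompact_Icc
    · rintro _ x ⟨j, rfl⟩
      exact abs_le.1 (hb j x x.2)
    · apply UniformEquicontinuous.equicontinuous
      apply LipschitzWith.uniformEquicontinuous _ M.toNNReal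
      rintro ⟨_, j, rfl⟩
      exact hL j
  obtain ⟨h, -, φ, hφ, hlim⟩ := hcomp.tendsto_subseq (x := g)
    (fun j => subset_closure (mem_range_self j))
  refine ⟨IccExtend zero_le_one h, φ, hφ, (h.continuous.Icc_extend').continuousOn, ?_⟩
  intro ε hε
  filter_upwards [Metric.tendsto_nhds.1 hlim ε hε] with j hj x hx
  rw [IccExtend_of_mem _ _ hx]
  have := (BoundedContinuousFunction.dist_coe_le_dist (f := g (φ j)) (g := h) ⟨x, hx⟩).trans hj.le
  exact this

end
end Osc

namespace Osc
section
variable {p r : ℝ → ℝ} {α : ℝ}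

lemma B_const_nonneg (H : Hyp p r α) : 0 ≤ B r α (fun _ => 1) (fun _ => 1) := B_nonneg H _

lemma Rel.opbound (H : Hyp p r α) : ∃ K, 0 ≤ K ∧ ∀ u f, Rel p r α u f →
    B r α u u ≤ K * B r α f f := by
  obtain ⟨C, hC, h⟩ := Rel.bound H
  refine ⟨B r α (fun _ => 1) (fun _ => 1) * C^2, mul_nonneg (B_nonneg H _) (sq_nonneg _), ?_⟩
  intro u f hr
  have := B_le H hr.co (h u f hr).1
  rw [mul_pow, Real.sq_sqrt (B_nonneg H f)] at this
  linarith

lemma unif_B (H : Hyp p r α) {g : ℕ → ℝ → ℝ} {h : ℝ → ℝ} (hg : ∀ j, CO (g j)) (hh : CO h)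
    (hu : ∀ ε > 0, ∀ᶠ j in Filter.atTop, ∀ x ∈ Icc (0:ℝ) 1, |g j x - h x| ≤ ε) :
    Filter.Tendsto (fun j => B r α (fun x => 1 * h x + (-1) * g j x) (fun x => 1 * h x + (-1) * g j x))
      Filter.atTop (nhds 0) := by
  set b := B r α (fun _ => 1) (fun _ => 1) with hb
  have hb0 : 0 ≤ b := B_nonneg H _
  rw [Metric.tendsto_nhds]
  intro ε hε
  have hε' : 0 < ε / (b + 1) := by positivity
  filter_upwards [hu (Real.sqrt (ε / (b + 1))) (Real.sqrt_pos.2 hε')] with j hj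
  have h1 := B_le H (hh.comb (hg j) 1 (-1)) (K := Real.sqrt (ε / (b + 1))) (fun x hx => by
    have := hj x hx
    rw [abs_sub_comm] at this
    have e : 1 * h x + (-1) * g j x = h x - g j x := by ring
    rw [e]; exact this)
  rw [Real.sq_sqrt hε'.le, ← hb] at h1
  rw [Real.dist_eq, sub_zero, abs_of_nonneg (B_nonneg H _)]
  refine h1.trans_lt ?_
  rw [mul_div_assoc', div_lt_iff₀ (by positivity)]
  nlinarith

lemma lim_eig (H : Hyp p r α) {h : ℝ → ℝ} (hh : CO h) {g g1 g2 : ℕ → ℝ → ℝ} {L : ℝ} (hL : 0 < L)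
    (hg : ∀ j, CO (g j)) (R1 : ∀ j, Rel p r α (g1 j) (g j)) (R2 : ∀ j, Rel p r α (g2 j) (g1 j))
    (b0 : ∀ j, B r α (g j) (g j) = 1)
    (b1 : Filter.Tendsto (fun j => B r α (g1 j) (g1 j)) Filter.atTop (nhds L))
    (b2 : Filter.Tendsto (fun j => B r α (g2 j) (g2 j)) Filter.atTop (nhds (L^2)))
    (hl : Filter.Tendsto (fun j => B r α (fun x => 1 * h x + (-1) * g j x)
      (fun x => 1 * h x + (-1) * g j x)) Filter.atTop (nhds 0)) :
    ∃ ν h1 w w1, Eg p r α ν h h1 w w1 := by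
  obtain ⟨u, Ru⟩ := Rel.exist H h hh
  obtain ⟨v, Rv⟩ := Rel.exist H u Ru.co
  obtain ⟨K, hK, hop⟩ := Rel.opbound H
  set E := fun j => B r α (fun x => 1 * h x + (-1) * g j x) (fun x => 1 * h x + (-1) * g j x) with hE
  have hd : CO (fun x => 1 * v x + (-L) * h x) := Rv.co.comb hh _ _
  have key : ∀ j, B r α (fun x => 1 * v x + (-L) * h x) (fun x => 1 * v x + (-L) * h x) ≤
      3 * (K * (K * E j) + (B r α (g2 j) (g2 j) - 2 * L * B r α (g1 j) (g1 j) + L^2) + L^2 * E j) := by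
    intro j
    have t1 : B r α (fun x => 1 * v x + (-1) * g2 j x) (fun x => 1 * v x + (-1) * g2 j x) ≤
        K * (K * E j) :=
      (hop _ _ (Rv.comb (R2 j) 1 (-1))).trans
        (mul_le_mul_of_nonneg_left (hop _ _ (Ru.comb (R1 j) 1 (-1))) hK)
    have t2 : B r α (fun x => 1 * g2 j x + (-L) * g j x) (fun x => 1 * g2 j x + (-L) * g j x) =
        B r α (g2 j) (g2 j) - 2 * L * B r α (g1 j) (g1 j) + L^2 := by
      rw [B_quad H (R2 j).co (hg j), b0 j, B_comm (g2 j) (g j), Rel.symm H (R1 j) (R2 j)]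
      ring
    have ce : CO (fun x => 1 * h x + (-1) * g j x) := hh.comb (hg j) _ _
    have t3 : B r α (fun x => (-L) * (1 * h x + (-1) * g j x) + 0 * h x)
        (fun x => (-L) * (1 * h x + (-1) * g j x) + 0 * h x) = L^2 * E j := by
      rw [B_quad H ce hh]; simp only [hE]; ring
    have := B_sum3 H (Rv.co.comb (R2 j).co 1 (-1)) ((R2 j).co.comb (hg j) 1 (-L))
      (ce.comb hh (-L) 0)
    rw [t2, t3] at this
    have e : B r α (fun x => 1 * v x + (-L) * h x) (fun x => 1 * v x + (-L) * h x) =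
      B r α (fun x => (1 * v x + (-1) * g2 j x) + (1 * g2 j x + (-L) * g j x) +
        ((-L) * (1 * h x + (-1) * g j x) + 0 * h x)) (fun x => (1 * v x + (-1) * g2 j x) +
        (1 * g2 j x + (-L) * g j x) + ((-L) * (1 * h x + (-1) * g j x) + 0 * h x)) :=
      B_congr (fun x _ => by ring) (fun x _ => by ring)
    rw [e]
    linarith
  have hlim : B r α (fun x => 1 * v x + (-L) * h x) (fun x => 1 * v x + (-L) * h x) ≤ 0 := by
    have T : Filter.Tendsto (fun j => 3 * (K * (K * E j) + (B r α (g2 j) (g2 j) -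
        2 * L * B r α (g1 j) (g1 j) + L^2) + L^2 * E j)) Filter.atTop
        (nhds (3 * (K * (K * 0) + (L^2 - 2 * L * L + L^2) + L^2 * 0))) :=
      ((((hl.const_mul K).const_mul K).add ((b2.sub (b1.const_mul (2 * L))).add_const (L^2))).add
        (hl.const_mul (L^2))).const_mul 3
    have := ge_of_tendsto' T key
    nlinarith
  have hv := B_zero H hd hlim
  set ρ := Real.sqrt L with hρ
  have hρ0 : 0 < ρ := Real.sqrt_pos.2 hL
  have hρ2 : ρ * ρ = L := Real.mul_self_sqrt hL.le
  have Rk := (Rv.comb Ru 1 (-ρ)).pos H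
  have ck : CO (fun x => 1 * u x + (-ρ) * h x) := Ru.co.comb hh _ _
  have hk : B r α (fun x => 1 * u x + (-ρ) * h x) (fun x => 1 * u x + (-ρ) * h x) ≤ 0 := by
    have e : B r α (fun x => 1 * u x + (-ρ) * h x) (fun x => 1 * v x + (-ρ) * u x) =
        B r α (fun x => 1 * u x + (-ρ) * h x)
          (fun x => (-ρ) * (1 * u x + (-ρ) * h x) + 0 * h x) :=
      B_congr (fun x _ => rfl) (fun x hx => by
        have := hv x hx
        rw [← hρ2] at this
        linear_combination this)
    rw [e, B_right H ck hh ck] at Rk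
    nlinarith
  have hu := B_zero H ck hk
  obtain ⟨h1, w, w1, S⟩ := Ru.comb Ru ρ⁻¹ 0
  refine ⟨ρ⁻¹, h1, w, w1, ⟨(S.congr' ?_).congr ?_, inv_pos.2 hρ0, ?_⟩⟩
  · intro x hx
    have := hu x hx
    have e : u x = ρ * h x := by linarith
    rw [e]; field_simp; ring
  · intro x hx
    simp
  · by_contra! hc
    have : ∀ j, (1:ℝ) ≤ E j := by
      intro j
      have : E j = B r α (g j) (g j) := by
        have e : E j = B r α (fun x => (-1) * g j x + 0 * h x) (fun x => (-1) * g j x + 0 * h x) :=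
          B_congr (fun x hx => by simp [hc x hx]) (fun x hx => by simp [hc x hx])
        rw [e, B_quad H (hg j) hh]; ring
      rw [this, b0 j]
    have := ge_of_tendsto' hl this
    linarith

end
end Osc

namespace Osc
section
variable {p r : ℝ → ℝ} {α : ℝ}

lemma Rel.smul {u f : ℝ → ℝ} (h : Rel p r α u f) (c : ℝ) :
    Rel p r α (fun x => c * u x) (fun x => c * f x) := by
  have := h.comb h c 0
  simpa using this

lemma B_smul (H : Hyp p r α) {f : ℝ → ℝ} (hf : CO f) (c : ℝ) :
    B r α (fun x => c * f x) (fun x => c * f x) = c^2 * B r α f f := by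
  have := B_quad H hf hf c 0
  simp only [zero_mul, add_zero] at this
  rw [this]; ring

lemma iter (H : Hyp p r α) {f : ℝ → ℝ} (hf : CO f) :
    ∃ F : ℕ → ℝ → ℝ, F 0 = f ∧ (∀ j, CO (F j)) ∧ ∀ j, Rel p r α (F (j+1)) (F j) := by
  choose! T hT using Rel.exist H
  have hc : ∀ j, CO (T^[j] f) := by
    intro j
    induction j with
    | zero => exact hf
    | succ j ih =>
      rw [Function.iterate_succ_apply']
      exact (hT _ ih).co
  refine ⟨fun j => T^[j] f, rfl, hc, fun j => ?_⟩
  show Rel p r α (T^[j+1] f) _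
  rw [Function.iterate_succ_apply']
  exact hT _ (hc j)

theorem power (H : Hyp p r α) {f : ℝ → ℝ} (hf : CO f) (hn : Nondeg f) :
    ∃ ν h h1 w w1, Eg p r α ν h h1 w w1 ∧
      (∀ m s, s ≠ 0 → Alt h (m+1) s 0 1 → Alt f (m+1) s 0 1) ∧
      (∀ mu z z1 zw zw1, Eg p r α mu z z1 zw zw1 → B r α f z = 0 → B r α h z = 0) := by
  obtain ⟨F, F0, Fc, FR⟩ := iter H hf
  have Fn : ∀ j, Nondeg (F j) := by
    intro j
    induction j with
    | zero => rw [F0]; exact hn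
    | succ j ih =>
      obtain ⟨_, _, _, S⟩ := FR j
      exact S.n4 H ih
  set a := fun j => B r α (F j) (F j) with ha
  have ap : ∀ j, 0 < a j := by
    intro j
    apply B_pos H (Fc j)
    obtain ⟨x, h1, h2, h3⟩ := Fn j 0 1 le_rfl zero_lt_one le_rfl
    exact ⟨x, ⟨h1.le, h2.le⟩, h3⟩
  have acs : ∀ j, a (j+1) ^ 2 ≤ a j * a (j+2) := by
    intro j
    have := B_cs H (Fc j) (Fc (j+2))
    rwa [Rel.symm H (FR j) (FR (j+1))] at this
  set q := fun j => a (j+1) / a j with hq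
  have qp : ∀ j, 0 < q j := fun j => div_pos (ap _) (ap _)
  have qm : Monotone q := by
    apply monotone_nat_of_le_succ
    intro j
    show a (j+1) / a j ≤ a (j+2) / a (j+1)
    rw [div_le_div_iff₀ (ap _) (ap _)]
    have := acs j
    nlinarith
  obtain ⟨K, hK, hop⟩ := Rel.opbound H
  have qb : BddAbove (range q) := by
    refine ⟨K, ?_⟩
    rintro _ ⟨j, rfl⟩
    show a (j+1) / a j ≤ K
    rw [div_le_iff₀ (ap j)]
    exact hop _ _ (FR j)
  have qlim := tendsto_atTop_ciSup qm qb
  set L := ⨆ i, q i with hL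
  have Lp : 0 < L := (qp 0).trans_le (le_ciSup qb 0)
  obtain ⟨C, hC, hbd⟩ := Rel.bound H
  set s := fun j => (Real.sqrt (a j))⁻¹ with hs
  have sp : ∀ j, 0 < s j := fun j => inv_pos.2 (Real.sqrt_pos.2 (ap j))
  have s2 : ∀ j, s j ^ 2 = (a j)⁻¹ := fun j => by
    simp only [hs, inv_pow, Real.sq_sqrt (ap j).le]
  set M := C / Real.sqrt (q 0) with hM
  have sM : ∀ j, s (j+1) * (C * Real.sqrt (a j)) ≤ M := by
    intro j
    have e : s (j+1) * (C * Real.sqrt (a j)) = C / Real.sqrt (q j) := by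
      simp only [hs, hq, Real.sqrt_div (ap (j+1)).le]
      have := Real.sqrt_pos.2 (ap j)
      have := Real.sqrt_pos.2 (ap (j+1))
      field_simp
    rw [e, hM]
    apply div_le_div_of_nonneg_left hC (Real.sqrt_pos.2 (qp 0))
    exact Real.sqrt_le_sqrt (qm (Nat.zero_le j))
  obtain ⟨h, φ, hφ, hhc, hunif⟩ := arzela (G := fun j x => s (j+1) * F (j+1) x) (M := M)
    (fun j x hx => by
      rw [abs_mul, abs_of_pos (sp _)]
      exact (mul_le_mul_of_nonneg_left ((hbd _ _ (FR j)).1 x hx) (sp _).le).trans (sM j))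
    (fun j x hx y hy => by
      rw [← mul_sub, abs_mul, abs_of_pos (sp _)]
      have t := mul_le_mul_of_nonneg_left ((hbd _ _ (FR j)).2 x hx y hy) (sp (j+1)).le
      rw [← mul_assoc] at t
      exact t.trans (mul_le_mul_of_nonneg_right (sM j) (abs_nonneg _)))
  set c := fun j => s (φ j + 1) with hc
  have cp : ∀ j, 0 < c j := fun j => sp _
  have gc : ∀ j, CO (fun x => c j * F (φ j + 1) x) := fun j => continuousOn_const.mul (Fc _)
  have hl := unif_B H gc hhc hunif
  have ql1 : Filter.Tendsto (fun j => q (φ j + 1)) Filter.atTop (nhds L) :=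
    (qlim.comp (Filter.tendsto_add_atTop_nat 1)).comp hφ.tendsto_atTop
  have ql2 : Filter.Tendsto (fun j => q (φ j + 2)) Filter.atTop (nhds L) :=
    (qlim.comp (Filter.tendsto_add_atTop_nat 2)).comp hφ.tendsto_atTop
  obtain ⟨ν, h1, w, w1, E⟩ := lim_eig H hhc Lp gc (fun j => (FR (φ j + 1)).smul (c j))
    (fun j => (FR (φ j + 2)).smul (c j))
    (fun j => by
      rw [B_smul H (Fc _), s2]
      exact inv_mul_cancel₀ (ap _).ne')
    (ql1.congr fun j => by
      rw [B_smul H (Fc _), s2]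
      simp only [hq, ha]
      field_simp)
    (by
      have := ql1.mul ql2
      rw [← pow_two] at this
      refine this.congr fun j => ?_
      rw [B_smul H (Fc _), s2]
      show a (φ j + 1 + 1) / a (φ j + 1) * (a (φ j + 2 + 1) / a (φ j + 2)) =
        (a (φ j + 1))⁻¹ * a (φ j + 2 + 1)
      have e1 := (ap (φ j + 1)).ne'
      have e2 := (ap (φ j + 2)).ne'
      show a (φ j + 2) / a (φ j + 1) * (a (φ j + 2 + 1) / a (φ j + 2)) = _
      field_simp)
    hl
  refine ⟨ν, h, h1, w, w1, E, ?_, ?_⟩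
  · intro m t ht hA
    have ev := hA.eventually (l := Filter.atTop) (G := fun j x => c j * F (φ j + 1) x)
      (fun x hx0 hx1 => by
        rw [Metric.tendsto_nhds]
        intro ε hε
        filter_upwards [hunif (ε/2) (by positivity)] with j hj
        rw [Real.dist_eq]
        exact (hj x ⟨hx0.le, hx1.le⟩).trans_lt (by linarith))
    obtain ⟨j, hj⟩ := ev.exists
    have hj' := hj.of_smul (cp j)
    have down : ∀ k, Alt (F k) (m+1) t 0 1 → Alt f (m+1) t 0 1 := by
      intro k
      induction k with
      | zero => rw [F0]; exact id
      | succ k ih =>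
        intro hk
        obtain ⟨_, _, _, S⟩ := FR k
        exact ih (S.KL H (Fn k) ht hk.weak)
    exact down _ hj'
  · intro mu z z1 zw zw1 Z hz
    have Rz : Rel p r α z (fun x => mu * z x) := ⟨_, _, _, Z.S⟩
    have zc : CO z := Rz.co
    have orth : ∀ k, B r α (F k) z = 0 := by
      intro k
      induction k with
      | zero => rw [F0]; exact hz
      | succ k ih =>
        have := Rel.symm H (FR k) Rz
        rw [ih] at this
        have e := B_right H zc zc (Fc (k+1)) mu 0
        simp only [zero_mul, add_zero] at e
        rw [e] at this
        rcases mul_eq_zero.1 this.symm with h | h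
        · exact absurd h Z.lp.ne'
        · exact h
    have le : ∀ j, B r α h z ^ 2 ≤ B r α (fun x => 1 * h x + (-1) * (c j * F (φ j + 1) x))
        (fun x => 1 * h x + (-1) * (c j * F (φ j + 1) x)) * B r α z z := by
      intro j
      have := B_cs H (hhc.comb (gc j) 1 (-1)) zc
      rw [B_left H hhc (gc j) zc] at this
      have e := B_left H (Fc (φ j + 1)) zc zc (c j) 0
      simp only [zero_mul, add_zero] at e
      rw [e, orth] at this
      simpa using this
    have := ge_of_tendsto' (hl.mul_const (B r α z z)) le
    rw [zero_mul] at this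
    exact pow_eq_zero_iff (two_ne_zero) |>.1 (le_antisymm this (sq_nonneg _))

end
end Osc

namespace Osc
section
variable {p r : ℝ → ℝ} {α : ℝ}

lemma Der.dv {g g' : ℝ → ℝ} (h : Der g g') {x : ℝ} (hx : x ∈ Icc (0:ℝ) 1) : Dv g x = g' x :=
  (h x hx).derivWithin (uniqueDiffOn_Icc zero_lt_one x hx)

lemma der_of_c2 {y : ℝ → ℝ} (h : ContDiffOn ℝ 2 y (Icc 0 1)) :
    Der y (Dv y) ∧ Der (Dv y) (Dv (Dv y)) := by
  have e : (2 : WithTop ℕ∞) = 1 + 1 := by norm_num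
  rw [e, contDiffOn_succ_iff_derivWithin (uniqueDiffOn_Icc zero_lt_one)] at h
  obtain ⟨h1, -, h2⟩ := h
  exact ⟨fun x hx => (h1 x hx).hasDerivWithinAt,
    fun x hx => (h2.differentiableOn one_ne_zero x hx).hasDerivWithinAt⟩

lemma c2_of_der {g g' g'' : ℝ → ℝ} (h : Der g g') (h' : Der g' g'') (hc : CO g'') :
    ContDiffOn ℝ 2 g (Icc 0 1) := by
  have ud : UniqueDiffOn ℝ (Icc (0:ℝ) 1) := uniqueDiffOn_Icc zero_lt_one
  have c1 : ∀ {k k' : ℝ → ℝ} {n : WithTop ℕ∞}, n ≠ ⊤ → Der k k' → ContDiffOn ℝ n k' (Icc 0 1) →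
      ContDiffOn ℝ (n+1) k (Icc 0 1) := by
    intro k k' n hn hk hk'
    rw [contDiffOn_succ_iff_derivWithin ud]
    exact ⟨fun x hx => (hk x hx).differentiableWithinAt, fun h => absurd h (by simpa using hn),
      hk'.congr fun x hx => hk.dv hx⟩
  have e : (2 : WithTop ℕ∞) = 0 + 1 + 1 := by norm_num
  rw [e]
  exact c1 (by simp) h (c1 (by simp) h' (contDiffOn_zero.2 hc))

lemma sys_of_sol (H : Hyp p r α) {lam : ℝ} {y : ℝ → ℝ} (hy : SolS p r lam y)
    (hb : BC2S p lam α y) :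
    Sys p r α y (Dv y) (fun x => p x * Dv (Dv y) x) (Dv (fun x => p x * Dv (Dv y) x))
      (fun x => lam * y x) := by
  obtain ⟨h1, h2, h3⟩ := hy
  obtain ⟨b0, b1, b2, b3⟩ := hb
  obtain ⟨a0, a1⟩ := der_of_c2 h1
  obtain ⟨a2, a3⟩ := der_of_c2 h2
  exact
  { d0 := a0
    d1 := a1.congr (fun _ _ => rfl) (fun x hx => by
      have := (H.pp x hx).ne'
      field_simp)
    d2 := a2
    d3 := a3.congr (fun _ _ => rfl) (fun x hx => by rw [h3 x hx]; ring)
    b0 := b0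
    b1 := b1
    b2 := b2
    b3 := by linarith
    fc := continuousOn_const.mul a0.cont }

lemma eg_of_sol (H : Hyp p r α) {lam : ℝ} {y : ℝ → ℝ} (hy : SolS p r lam y)
    (hnt : Nontriv y) (hb : BC2S p lam α y) :
    Eg p r α lam y (Dv y) (fun x => p x * Dv (Dv y) x) (Dv (fun x => p x * Dv (Dv y) x)) := by
  have S := sys_of_sol H hy hb
  refine ⟨S, ?_, hnt⟩
  have R : Rel p r α y (fun x => lam * y x) := ⟨_, _, _, S⟩
  have yc : CO y := R.co
  have hp := B_pos H yc hnt
  have h0 := R.pos H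
  have e := B_left H yc yc yc lam 0
  simp only [zero_mul, add_zero] at e
  rw [e] at h0
  have h1 : 0 ≤ lam := nonneg_of_mul_nonneg_left h0 hp
  rcases h1.eq_or_lt with h | h
  · exfalso
    obtain ⟨K, hK, hop⟩ := Rel.opbound H
    have := hop _ _ R
    rw [B_smul H yc, ← h] at this
    nlinarith
  · exact h

lemma eig_of_eg (H : Hyp p r α) {lam : ℝ} {y y1 w w1 : ℝ → ℝ} (E : Eg p r α lam y y1 w w1) :
    EigS2 p r α lam := by
  have S := E.S
  have i0 : (0:ℝ) ∈ Icc (0:ℝ) 1 := ⟨le_rfl, zero_le_one⟩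
  have i1 : (1:ℝ) ∈ Icc (0:ℝ) 1 := ⟨zero_le_one, le_rfl⟩
  have D1 : Der (Dv y) (fun x => w x / p x) := S.d1.congr (fun x hx => S.d0.dv hx) (fun _ _ => rfl)
  have e : ∀ x ∈ Icc (0:ℝ) 1, p x * Dv (Dv y) x = w x := by
    intro x hx
    rw [D1.dv hx]
    have := (H.pp x hx).ne'
    field_simp
  have D2 : Der (fun x => p x * Dv (Dv y) x) w1 := S.d2.congr e (fun _ _ => rfl)
  have D3 : Der (Dv (fun x => p x * Dv (Dv y) x)) (fun x => r x * (lam * y x)) :=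
    S.d3.congr (fun x hx => D2.dv hx) (fun _ _ => rfl)
  refine ⟨y, ⟨c2_of_der S.d0 S.d1 (S.d2.cont.div H.pc fun x hx => (H.pp x hx).ne'),
    c2_of_der D2 S.d3 (H.rc.mul S.fc), ?_⟩, E.nt, S.b0, ?_, ?_, ?_⟩
  · intro x hx
    rw [D3.dv hx]; ring
  · rw [S.d0.dv i0, S.b1]
  · rw [S.d0.dv i1, S.b2]
  · rw [D2.dv i1, S.b3]; ring

lemma exists_poly (H : Hyp p r α) {n : ℕ} {M : Set ℝ} (hM : M.Finite) (hlt : M.ncard < n)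
    (z : ℝ → ℝ → ℝ) (hz : ∀ μ ∈ M, CO (z μ)) :
    ∃ P : Polynomial ℝ, P ≠ 0 ∧ P.natDegree < n ∧
      ∀ μ ∈ M, B r α (fun x => P.eval x) (z μ) = 0 := by
  have : Fintype M := hM.fintype
  have pc : ∀ P : Polynomial ℝ, CO (fun x => P.eval x) := fun P => P.continuous.continuousOn
  let Λ : Polynomial.degreeLT ℝ n →ₗ[ℝ] (M → ℝ) :=
    { toFun := fun P μ => B r α (fun x => (P : Polynomial ℝ).eval x) (z μ)
      map_add' := by
        intro P Q
        ext μ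
        have := B_left H (pc P) (pc Q) (hz μ μ.2) 1 1
        simpa using this
      map_smul' := by
        intro c P
        ext μ
        have := B_left H (pc P) (pc P) (hz μ μ.2) c 0
        simpa using this }
  have : Module.Finite ℝ (Polynomial.degreeLT ℝ n) :=
    Module.Finite.equiv (Polynomial.degreeLTEquiv ℝ n).symm
  have hk : LinearMap.ker Λ ≠ ⊥ := by
    apply LinearMap.ker_ne_bot_of_finrank_lt
    rw [(Polynomial.degreeLTEquiv ℝ n).finrank_eq]
    rw [Module.finrank_fintype_fun_eq_card, Module.finrank_fintype_fun_eq_card, Fintype.card_fin,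
      ← Nat.card_eq_fintype_card]
    exact hlt
  obtain ⟨P, hP, hP0⟩ := Submodule.exists_mem_ne_zero_of_ne_bot hk
  have hne : (P : Polynomial ℝ) ≠ 0 := fun h => hP0 (Subtype.ext h)
  refine ⟨P, hne, ?_, ?_⟩
  · have := Polynomial.mem_degreeLT.1 P.2
    exact (Polynomial.natDegree_lt_iff_degree_lt hne).2 this
  · intro μ hμ
    exact congrFun (LinearMap.mem_ker.1 hP) ⟨μ, hμ⟩

lemma poly_nondeg {P : Polynomial ℝ} (hP : P ≠ 0) : Nondeg (fun x => P.eval x) := by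
  intro x y _ hxy _
  by_contra! hc
  apply hP
  apply Polynomial.eq_zero_of_infinite_isRoot
  exact (Ioo_infinite hxy).mono fun t ht => hc t ht.1 ht.2

lemma poly_alt {P : Polynomial ℝ} (hP : P ≠ 0) {m : ℕ} {s : ℝ}
    (h : Alt (fun x => P.eval x) (m+1) s 0 1) : m ≤ P.natDegree := by
  obtain ⟨Z, hZ, hz⟩ := h.zeros P.continuous.continuousOn
  rw [← hZ]
  apply Polynomial.card_le_degree_of_subset_roots
  intro t ht
  rw [Polynomial.mem_roots hP]
  exact (hz t ht).2.2

end
end Osc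

theorem stmt_9 (p r : ℝ → ℝ) (alpha : ℝ) (n : ℕ) (lam : ℝ) (y : ℝ → ℝ)
    (hpc : ContinuousOn p (Icc 0 1)) (hrc : ContinuousOn r (Icc 0 1))
    (hp : ∀ x ∈ Icc (0:ℝ) 1, 0 < p x) (hr : ∀ x ∈ Icc (0:ℝ) 1, 0 < r x)
    (halpha : 0 ≤ alpha) (hn : 1 ≤ n)
    (heig : EigS2 p r alpha lam)
    (hfin : {μ : ℝ | EigS2 p r alpha μ ∧ μ < lam}.Finite)
    (hcard : {μ : ℝ | EigS2 p r alpha μ ∧ μ < lam}.ncard = n - 1)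
    (hy : SolS p r lam y) (hnt : Nontriv y) (hbc : BC2S p lam alpha y) :
    {x ∈ Ioo (0:ℝ) 1 | y x = 0}.Finite ∧
      {x ∈ Ioo (0:ℝ) 1 | y x = 0}.ncard = n - 1 ∧
      ∀ a ∈ Ioo (0:ℝ) 1, y a = 0 → Dv y a ≠ 0 := by
  have H : Osc.Hyp p r alpha := ⟨hpc, hrc, hp, hr, halpha⟩
  have E := Osc.eg_of_sol H hy hnt hbc
  refine ⟨E.finite H, ?_, fun a ha h0 => E.simple H ha.1 ha.2 h0⟩
  have hex : ∀ μ, EigS2 p r alpha μ → ∃ z z1 zw zw1, Osc.Eg p r alpha μ z z1 zw zw1 := by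
    rintro μ ⟨z, h1, h2, h3⟩
    exact ⟨_, _, _, _, Osc.eg_of_sol H h1 h2 h3⟩
  choose! z z1 zw zw1 hz using hex
  set M := {μ : ℝ | EigS2 p r alpha μ ∧ μ < lam} with hM
  apply le_antisymm
  · obtain ⟨P, hP0, hPd, hPo⟩ := Osc.exists_poly H hfin (n := n) (by omega) z
      (fun μ hμ => (hz μ hμ.1).S.d0.cont)
    obtain ⟨ν, h, h1, w, w1, Eh, hA, hO⟩ := Osc.power H (f := fun x => P.eval x)
      P.continuous.continuousOn (Osc.poly_nondeg hP0)
    have hcd : {x ∈ Ioo (0:ℝ) 1 | h x = 0}.ncard ≤ n - 1 := by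
      obtain ⟨s, hs, h⟩ := Eh.alt_card H
      have := Osc.poly_alt hP0 (hA _ s hs h)
      omega
    have hν : lam ≤ ν := by
      by_contra! hlt
      have hμ : ν ∈ M := ⟨Osc.eig_of_eg H Eh, hlt⟩
      have Ez := hz ν hμ.1
      have o := hO _ _ _ _ _ Ez (hPo ν hμ)
      have zc : Osc.CO (z ν) := Ez.S.d0.cont
      have hc : Osc.CO h := Eh.S.d0.cont
      have e1 := Osc.B_left H hc zc zc (z ν 1) 0
      have e2 := Osc.B_left H zc zc zc (h 1) 0
      have e3 := Osc.B_congr (r := r) (α := alpha) (f := fun x => z ν 1 * h x + 0 * z ν x)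
        (f' := fun x => h 1 * z ν x + 0 * z ν x)
        (g := z ν) (g' := z ν) (fun x hx => by
          have := Eh.prop H Ez x hx
          simp only [this]) (fun _ _ => rfl)
      rw [e1, e2, o] at e3
      have := mul_ne_zero (Eh.ne1 H) (Osc.B_pos H zc Ez.nt).ne'
      apply this
      linarith
    refine le_trans ?_ hcd
    rcases hν.eq_or_lt with h' | h'
    · subst h'
      apply le_of_eq
      congr 1
      ext x
      simp only [mem_setOf_eq]
      constructor
      · rintro ⟨hx, h0⟩
        refine ⟨hx, ?_⟩
        have := E.prop H Eh x (Ioo_subset_Icc_self hx)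
        rw [h0, mul_zero] at this
        exact (mul_eq_zero.1 this.symm).resolve_left (E.ne1 H)
      · rintro ⟨hx, h0⟩
        refine ⟨hx, ?_⟩
        have := E.prop H Eh x (Ioo_subset_Icc_self hx)
        rw [h0, mul_zero] at this
        exact (mul_eq_zero.1 this).resolve_left (Eh.ne1 H)
    · exact (E.card_lt H Eh h').le
  · rw [← hcard, ← Finset.card_range {x ∈ Ioo (0:ℝ) 1 | y x = 0}.ncard,
      Set.ncard_eq_toFinset_card _ hfin]
    apply Finset.card_le_card_of_injOn (fun μ => {x ∈ Ioo (0:ℝ) 1 | z μ x = 0}.ncard)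
    · intro μ hμ
      have hμ' : μ ∈ M := by simpa using hμ
      simp only [Finset.coe_range, mem_Iio]
      exact (hz μ hμ'.1).card_lt H E hμ'.2
    · intro μ hμ μ' hμ' he
      have k : μ ∈ M := by simpa using hμ
      have k' : μ' ∈ M := by simpa using hμ'
      simp only at he
      rcases lt_trichotomy μ μ' with h | h | h
      · have := (hz μ k.1).card_lt H (hz μ' k'.1) h
        omega
      · exact h
      · have := (hz μ' k'.1).card_lt H (hz μ k.1) h
        omega
end

section
/- Let p, r : [0,1] → ℝ be continuous with p(x) > 0 and r(x) > 0 for all x ∈ [0,1], and let c, α ∈ ℝ. Suppose λ ∈ Λ(p). Then it is impossible that simultaneously (i) there exists a nontrivial classical solution of (p·y'')'' − λ·(−y'' + c·r·y) = 0 satisfying y(0) = y'(0) = y(1) = y'(1) = 0, and (ii) there exists a nontrivial classical solution of the same equation satisfying y(0) = y'(0) = y'(1) = 0 and (p·y'')'(1) + λ·α·y(1) = 0. -/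
open Set

/-- `y` is a classical solution of `(p y'')'' - lam * (-y'' + c r y) = 0` on `[0,1]`. -/
def SolT (p r : ℝ → ℝ) (c lam : ℝ) (y : ℝ → ℝ) : Prop :=
  ContDiffOn ℝ 2 y (Set.Icc 0 1) ∧
  ContDiffOn ℝ 2 (fun x => p x * Dv (Dv y) x) (Set.Icc 0 1) ∧
  ∀ x ∈ Set.Icc (0:ℝ) 1,
    Dv (Dv (fun t => p t * Dv (Dv y) t)) x
      - lam * (-(Dv (Dv y) x) + c * r x * y x) = 0

/-- Boundary conditions `y(0) = y'(0) = y'(1) = 0`, `(p y'')'(1) + lam * alpha * y(1) = 0`. -/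
def BC2 (p : ℝ → ℝ) (lam alpha : ℝ) (y : ℝ → ℝ) : Prop :=
  y 0 = 0 ∧ Dv y 0 = 0 ∧ Dv y 1 = 0 ∧
  Dv (fun t => p t * Dv (Dv y) t) 1 + lam * alpha * y 1 = 0

/-- `μ` is a Dirichlet eigenvalue of the Sturm–Liouville problem
`-(p w')' = μ w`, `w(0) = w(1) = 0` on `[0,1]`. -/
def DirichletEig (p : ℝ → ℝ) (μ : ℝ) : Prop :=
  ∃ w : ℝ → ℝ, ContDiffOn ℝ 1 w (Set.Icc 0 1) ∧
    ContDiffOn ℝ 1 (fun x => p x * Dv w x) (Set.Icc 0 1) ∧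
    (∀ x ∈ Set.Icc (0:ℝ) 1, -(Dv (fun t => p t * Dv w t) x) = μ * w x) ∧
    Nontriv w ∧ w 0 = 0 ∧ w 1 = 0

/-- The admissible set `Λ(p)`: all `lam` lying strictly below every Dirichlet
eigenvalue of `-(p w')'` on `[0,1]`. -/
def AdmSet (p : ℝ → ℝ) : Set ℝ := {lam : ℝ | ∀ μ : ℝ, DirichletEig p μ → lam < μ}


noncomputable def UU (q : ℝ → ℝ) : ℕ → ℝ → ℝ
  | 0 => fun x => ∫ t in (0:ℝ)..x, q t
  | n+1 => fun x => ∫ t in (0:ℝ)..x, q t * ∫ s in (0:ℝ)..t, UU q n s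

lemma prim_cont (f : ℝ → ℝ) (hf : Continuous f) : Continuous (fun x => ∫ t in (0:ℝ)..x, f t) :=
  intervalIntegral.continuous_primitive (fun a b => hf.intervalIntegrable a b) 0

lemma UU_cont (q : ℝ → ℝ) (hq : Continuous q) (n : ℕ) : Continuous (UU q n) := by
  induction n with
  | zero => exact prim_cont q hq
  | succ n ih => exact prim_cont _ (hq.mul (prim_cont _ ih))

lemma UU_bound (q : ℝ → ℝ) (hq : Continuous q) (M : ℝ) (hq0 : ∀ x, 0 ≤ q x) (hM : ∀ x, q x ≤ M)
    (n : ℕ) : ∀ x ∈ Icc (0:ℝ) 1, 0 ≤ UU q n x ∧ UU q n x ≤ M^(n+1) * x^n / n.factorial := by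
  have hM0 : 0 ≤ M := (hq0 0).trans (hM 0)
  induction n with
  | zero =>
    intro x hx
    refine ⟨intervalIntegral.integral_nonneg hx.1 (fun t _ => hq0 t), ?_⟩
    have := intervalIntegral.integral_mono_on (μ := MeasureTheory.volume) hx.1
      (hq.intervalIntegrable 0 x) (continuous_const (y := M) |>.intervalIntegrable 0 x)
      (fun t _ => hM t)
    simp only [UU]
    simp at this ⊢
    nlinarith [hx.1, hx.2]
  | succ n ih =>
    intro x hx
    have hU := UU_cont q hq n
    have hP := prim_cont _ hU
    have h1 : ∀ t ∈ Icc (0:ℝ) x, 0 ≤ ∫ s in (0:ℝ)..t, UU q n s := fun t ht =>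
      intervalIntegral.integral_nonneg ht.1 (fun s hs => (ih s ⟨hs.1, hs.2.trans (ht.2.trans hx.2)⟩).1)
    have h2 : ∀ t ∈ Icc (0:ℝ) x, ∫ s in (0:ℝ)..t, UU q n s ≤ M^(n+1) * t^n / n.factorial := by
      intro t ht
      have ht1 := ht.2.trans hx.2
      have := intervalIntegral.integral_mono_on (μ := MeasureTheory.volume) (f := UU q n)
        (g := fun _ => M^(n+1) * t^n / n.factorial) ht.1
        (hU.intervalIntegrable 0 t) (continuous_const.intervalIntegrable 0 t)
        (fun s hs => (ih s ⟨hs.1, hs.2.trans ht1⟩).2.trans (by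
          have := hs.1
          have := hs.2
          gcongr))
      refine this.trans ?_
      simp only [intervalIntegral.integral_const, smul_eq_mul, sub_zero]
      have : 0 ≤ M^(n+1) * t^n / n.factorial := by have := ht.1; positivity
      nlinarith
    refine ⟨intervalIntegral.integral_nonneg hx.1 (fun t ht => mul_nonneg (hq0 t) (h1 t ht)), ?_⟩
    have := intervalIntegral.integral_mono_on (μ := MeasureTheory.volume)
        (f := fun t => q t * ∫ s in (0:ℝ)..t, UU q n s)
        (g := fun t => M * (M^(n+1) / n.factorial) * t^n) hx.1
        ((hq.mul hP).intervalIntegrable 0 x)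
        ((continuous_const.mul (continuous_pow n)).intervalIntegrable 0 x)
        (fun t ht => by
          have := h2 t ht
          have h3 := h1 t ht
          calc q t * ∫ s in (0:ℝ)..t, UU q n s ≤ M * (M^(n+1) * t^n / n.factorial) :=
                mul_le_mul (hM t) this h3 hM0
            _ = _ := by ring)
    refine this.trans (le_of_eq ?_)
    rw [intervalIntegral.integral_const_mul, integral_pow, Nat.factorial_succ]
    push_cast
    field_simp
    simp
    ring

noncomputable def cl (x : ℝ) : ℝ := max 0 (min 1 x)
lemma cl_cont : Continuous cl := by unfold cl; fun_prop
lemma cl_mem (x : ℝ) : cl x ∈ Icc (0:ℝ) 1 := ⟨le_max_left _ _, max_le zero_le_one (min_le_left _ _)⟩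
lemma cl_eq {x : ℝ} (hx : x ∈ Icc (0:ℝ) 1) : cl x = x := by
  unfold cl; rw [min_eq_right hx.2, max_eq_right hx.1]

noncomputable def Ph (q : ℝ → ℝ) (μ x : ℝ) : ℝ := ∑' n, (-μ)^n * UU q n (cl x)

lemma term_bound (q : ℝ → ℝ) (hq : Continuous q) (M : ℝ) (hq0 : ∀ x, 0 ≤ q x) (hM : ∀ x, q x ≤ M)
    (R μ : ℝ) (hR : |μ| ≤ R) (n : ℕ) (x : ℝ) (hx : x ∈ Icc (0:ℝ) 1) :
    ‖(-μ)^n * UU q n x‖ ≤ M * ((R*M)^n / n.factorial) := by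
  have hM0 : 0 ≤ M := (hq0 0).trans (hM 0)
  obtain ⟨h1, h2⟩ := UU_bound q hq M hq0 hM n x hx
  rw [norm_mul, norm_pow, norm_neg, Real.norm_eq_abs, Real.norm_eq_abs, abs_of_nonneg h1]
  have h3 : UU q n x ≤ M^(n+1) / n.factorial := h2.trans (by
    gcongr
    have : x^n ≤ 1 := pow_le_one₀ hx.1 hx.2
    have h4 : 0 ≤ M^(n+1) := by positivity
    nlinarith)
  calc |μ|^n * UU q n x ≤ R^n * (M^(n+1) / n.factorial) := by
        have := (abs_nonneg μ).trans hR
        gcongr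
    _ = _ := by rw [mul_pow]; ring

lemma bound_summable (M R : ℝ) : Summable (fun n : ℕ => M * ((R*M)^n / n.factorial)) :=
  (Real.summable_pow_div_factorial (R*M)).mul_left M

lemma Ph_cont (q : ℝ → ℝ) (hq : Continuous q) (M : ℝ) (hq0 : ∀ x, 0 ≤ q x) (hM : ∀ x, q x ≤ M) :
    Continuous (fun z : ℝ × ℝ => Ph q z.1 z.2) := by
  rw [continuous_iff_continuousAt]
  intro z
  have h : ContinuousOn (fun z : ℝ × ℝ => Ph q z.1 z.2) {w : ℝ × ℝ | |w.1| ≤ |z.1| + 1} := by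
    unfold Ph
    apply continuousOn_tsum (u := fun n : ℕ => M * (((|z.1|+1)*M)^n / n.factorial))
    · intro n
      apply Continuous.continuousOn
      exact (continuous_fst.neg.pow n).mul ((UU_cont q hq n).comp (cl_cont.comp continuous_snd))
    · exact bound_summable _ _
    · intro n w hw
      exact term_bound q hq M hq0 hM _ _ hw n _ (cl_mem _)
  apply h.continuousAt
  have : IsOpen {w : ℝ × ℝ | |w.1| < |z.1| + 1} :=
    isOpen_lt (continuous_fst.abs) continuous_const
  exact Filter.mem_of_superset (this.mem_nhds (by simp)) (fun w hw => le_of_lt (show |w.1| < |z.1| + 1 from hw))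

lemma hasSum_int (f : ℕ → ℝ → ℝ) (F : ℝ → ℝ) (b : ℕ → ℝ) (hb : Summable b)
    (hf : ∀ n, Continuous (f n)) (hfb : ∀ n, ∀ x ∈ Icc (0:ℝ) 1, ‖f n x‖ ≤ b n)
    (hF : ∀ x ∈ Icc (0:ℝ) 1, HasSum (fun n => f n x) (F x)) (x : ℝ) (hx : x ∈ Icc (0:ℝ) 1) :
    HasSum (fun n => ∫ t in (0:ℝ)..x, f n t) (∫ t in (0:ℝ)..x, F t) := by
  have hm : ∀ t ∈ uIoc (0:ℝ) x, t ∈ Icc (0:ℝ) 1 := by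
    intro t ht
    rw [uIoc_of_le hx.1] at ht
    exact ⟨ht.1.le, ht.2.trans hx.2⟩
  apply intervalIntegral.hasSum_integral_of_dominated_convergence (fun n _ => b n)
  · intro n; exact (hf n).aestronglyMeasurable
  · intro n; exact Filter.Eventually.of_forall (fun t ht => hfb n t (hm t ht))
  · exact Filter.Eventually.of_forall (fun t ht => hb)
  · exact continuous_const.intervalIntegrable _ _
  · exact Filter.Eventually.of_forall (fun t ht => hF t (hm t ht))

lemma int_bound (f : ℝ → ℝ) (C : ℝ) (hf : ∀ x ∈ Icc (0:ℝ) 1, ‖f x‖ ≤ C) (x : ℝ)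
    (hx : x ∈ Icc (0:ℝ) 1) : ‖∫ t in (0:ℝ)..x, f t‖ ≤ C := by
  have hC : 0 ≤ C := (norm_nonneg _).trans (hf x hx)
  have := intervalIntegral.norm_integral_le_of_norm_le_const (a := 0) (b := x) (C := C) (f := f) (by
    intro t ht
    rw [uIoc_of_le hx.1] at ht
    exact hf t ⟨ht.1.le, ht.2.trans hx.2⟩)
  rw [sub_zero, abs_of_nonneg hx.1] at this
  nlinarith [hx.2]

noncomputable def Ps (q : ℝ → ℝ) (μ x : ℝ) : ℝ := 1 - μ * ∫ t in (0:ℝ)..x, Ph q μ t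

lemma Ph_eq (q : ℝ → ℝ) (hq : Continuous q) (M : ℝ) (hq0 : ∀ x, 0 ≤ q x) (hM : ∀ x, q x ≤ M)
    (μ x : ℝ) (hx : x ∈ Icc (0:ℝ) 1) : Ph q μ x = ∫ t in (0:ℝ)..x, q t * Ps q μ t := by
  have hM0 : 0 ≤ M := (hq0 0).trans (hM 0)
  set b : ℕ → ℝ := fun n => M * ((|μ| * M)^n / n.factorial) with hbdef
  have hb : Summable b := bound_summable _ _
  have hP : ∀ x ∈ Icc (0:ℝ) 1, HasSum (fun n => (-μ)^n * UU q n x) (Ph q μ x) := by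
    intro x hx
    unfold Ph
    rw [cl_eq hx]
    exact (Summable.of_norm_bounded hb (fun n => term_bound q hq M hq0 hM _ μ le_rfl n x hx)).hasSum
  have hfc : ∀ n, Continuous (fun x => (-μ)^n * UU q n x) := fun n =>
    continuous_const.mul (UU_cont q hq n)
  have hfb : ∀ n, ∀ x ∈ Icc (0:ℝ) 1, ‖(-μ)^n * UU q n x‖ ≤ b n := fun n x hx =>
    term_bound q hq M hq0 hM _ μ le_rfl n x hx
  have h1 := hasSum_int _ _ b hb hfc hfb hP
  have h2 := hasSum_int (fun n t => q t * ∫ s in (0:ℝ)..t, (-μ)^n * UU q n s)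
    (fun t => q t * ∫ s in (0:ℝ)..t, Ph q μ s) (fun n => M * b n) (hb.mul_left M)
    (fun n => hq.mul (prim_cont _ (hfc n)))
    (fun n x hx => by
      rw [norm_mul, Real.norm_eq_abs, abs_of_nonneg (hq0 x)]
      exact mul_le_mul (hM x) (int_bound _ _ (hfb n) x hx) (norm_nonneg _) hM0)
    (fun x hx => (h1 x hx).mul_left _) x hx
  have h3 : ∀ n, (∫ t in (0:ℝ)..x, q t * ∫ s in (0:ℝ)..t, (-μ)^n * UU q n s)
      = (-μ)^n * UU q (n+1) x := by
    intro n
    simp only [UU, intervalIntegral.integral_const_mul]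
    rw [← intervalIntegral.integral_const_mul]
    congr 1; ext t; ring
  simp only [h3] at h2
  have h4 : HasSum (fun n => (-μ)^(n+1) * UU q (n+1) x)
      (-μ * ∫ t in (0:ℝ)..x, q t * ∫ s in (0:ℝ)..t, Ph q μ s) := by
    have e : (fun n => (-μ)^(n+1) * UU q (n+1) x) = fun n => -μ * ((-μ)^n * UU q (n+1) x) := by
      funext n; ring
    rw [e]
    exact h2.mul_left (-μ)
  have h5 := (hasSum_nat_add_iff' (f := fun n => (-μ)^n * UU q n x) 1).2 (hP x hx)
  have h6 := h4.unique h5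
  simp only [Finset.range_one, Finset.sum_singleton, pow_zero, one_mul, UU] at h6
  have hPc : Continuous (Ph q μ) := (Ph_cont q hq M hq0 hM).comp (by fun_prop : Continuous (fun x : ℝ => (μ, x)))
  have h7 : (∫ t in (0:ℝ)..x, q t * Ps q μ t) = (∫ t in (0:ℝ)..x, q t)
      - μ * ∫ t in (0:ℝ)..x, q t * ∫ s in (0:ℝ)..t, Ph q μ s := by
    rw [← intervalIntegral.integral_const_mul, ← intervalIntegral.integral_sub]
    · congr 1; ext t; unfold Ps; ring
    · exact hq.intervalIntegrable _ _
    · exact (continuous_const.mul (hq.mul (prim_cont _ hPc))).intervalIntegrable _ _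
  rw [h7]; linarith

lemma exists_phi (q : ℝ → ℝ) (hq : Continuous q) (M : ℝ) (hq0 : ∀ x, 0 < q x) (hM : ∀ x, q x ≤ M) :
    ∃ φ ψ : ℝ → ℝ → ℝ, Continuous (fun z : ℝ × ℝ => φ z.1 z.2) ∧
      Continuous (fun z : ℝ × ℝ => ψ z.1 z.2) ∧ 
      (∀ μ, φ μ 0 = 0 ∧ ψ μ 0 = 1) ∧
      (∀ μ, ∀ x ∈ Icc (0:ℝ) 1, HasDerivWithinAt (φ μ) (q x * ψ μ x) (Icc 0 1) x) ∧
      (∀ μ, ∀ x ∈ Icc (0:ℝ) 1, HasDerivWithinAt (ψ μ) (-μ * φ μ x) (Icc 0 1) x) ∧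
      (∀ μ ≤ 0, ∀ x ∈ Ioc (0:ℝ) 1, 0 < φ μ x) := by
  have hq0' := fun x => (hq0 x).le
  have hc := Ph_cont q hq M hq0' hM
  have hPc : ∀ μ, Continuous (Ph q μ) := fun μ => hc.comp (by fun_prop : Continuous (fun x : ℝ => (μ, x)))
  have hsc : Continuous (fun z : ℝ × ℝ => Ps q z.1 z.2) := by
    unfold Ps
    have : Continuous (fun z : ℝ × ℝ => ∫ t in (0:ℝ)..z.2, Ph q z.1 t) := by
      apply intervalIntegral.continuous_parametric_intervalIntegral_of_continuous
      · exact hc.comp (by fun_prop : Continuous (fun w : (ℝ × ℝ) × ℝ => (w.1.1, w.2)))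
      · fun_prop
    fun_prop
  have hsc' : ∀ μ, Continuous (Ps q μ) := fun μ => hsc.comp (by fun_prop : Continuous (fun x : ℝ => (μ, x)))
  refine ⟨Ph q, Ps q, hc, hsc, ?_, ?_, ?_, ?_⟩
  · intro μ
    refine ⟨?_, by simp [Ps]⟩
    rw [Ph_eq q hq M hq0' hM μ 0 (by simp)]; simp
  · intro μ x hx
    have h : HasDerivAt (fun x => ∫ t in (0:ℝ)..x, q t * Ps q μ t) (q x * Ps q μ x) x :=
      ((hq.mul (hsc' μ)).integral_hasStrictDerivAt 0 x).hasDerivAt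
    exact h.hasDerivWithinAt.congr (fun y hy => Ph_eq q hq M hq0' hM μ y hy) (Ph_eq q hq M hq0' hM μ x hx)
  · intro μ x hx
    have h : HasDerivAt (fun x => ∫ t in (0:ℝ)..x, Ph q μ t) (Ph q μ x) x :=
      ((hPc μ).integral_hasStrictDerivAt 0 x).hasDerivAt
    have h2 := ((h.const_mul μ).const_sub 1)
    have e : -μ * Ph q μ x = -(μ * Ph q μ x) := by ring
    rw [e]
    exact h2.hasDerivWithinAt
  · intro μ hμ x hx
    have hx' : x ∈ Icc (0:ℝ) 1 := ⟨hx.1.le, hx.2⟩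
    have hs : Summable (fun n => (-μ)^n * UU q n (cl x)) :=
      Summable.of_norm_bounded (bound_summable M |μ|) 
        (fun n => term_bound q hq M hq0' hM _ μ le_rfl n _ (cl_mem x))
    refine hs.tsum_pos (fun n => mul_nonneg (pow_nonneg (by linarith) n) 
      (UU_bound q hq M hq0' hM n _ (cl_mem x)).1) 0 ?_
    rw [cl_eq hx', pow_zero, one_mul]
    exact intervalIntegral.intervalIntegral_pos_of_pos (hq.intervalIntegrable _ _) hq0 hx.1

lemma C1_of (f f' : ℝ → ℝ) (h : ∀ x ∈ Icc (0:ℝ) 1, HasDerivWithinAt f (f' x) (Icc 0 1) x)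
    (hc : ContinuousOn f' (Icc 0 1)) : ContDiffOn ℝ 1 f (Icc 0 1) := by
  have hu : UniqueDiffOn ℝ (Icc (0:ℝ) 1) := uniqueDiffOn_Icc zero_lt_one
  rw [show (1 : WithTop ℕ∞) = 0 + 1 from (zero_add 1).symm, contDiffOn_succ_iff_derivWithin hu]
  refine ⟨fun x hx => (h x hx).differentiableWithinAt, by simp, ?_⟩
  rw [contDiffOn_zero]
  exact hc.congr (fun x hx => (h x hx).derivWithin (hu x hx))

lemma mono_of {f f' : ℝ → ℝ} {a b : ℝ} (ha : 0 ≤ a) (hb : b ≤ 1)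
    (h : ∀ x ∈ Icc a b, HasDerivWithinAt f (f' x) (Icc 0 1) x)
    (hp : ∀ x ∈ Ioo a b, 0 ≤ f' x) : MonotoneOn f (Icc a b) := by
  have hs : Icc a b ⊆ Icc 0 1 := Icc_subset_Icc ha hb
  apply monotoneOn_of_hasDerivWithinAt_nonneg (convex_Icc a b) (f' := f')
  · exact fun x hx => ((h x hx).continuousWithinAt).mono hs
  · intro x hx
    exact (h x (interior_subset hx)).mono (interior_subset.trans hs)
  · rw [interior_Icc]; exact hp

lemma anti_of {f f' : ℝ → ℝ} {a b : ℝ} (ha : 0 ≤ a) (hb : b ≤ 1)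
    (h : ∀ x ∈ Icc a b, HasDerivWithinAt f (f' x) (Icc 0 1) x)
    (hp : ∀ x ∈ Ioo a b, f' x ≤ 0) : AntitoneOn f (Icc a b) := by
  have hs : Icc a b ⊆ Icc 0 1 := Icc_subset_Icc ha hb
  apply antitoneOn_of_hasDerivWithinAt_nonpos (convex_Icc a b) (f' := f')
  · exact fun x hx => ((h x hx).continuousWithinAt).mono hs
  · intro x hx
    exact (h x (interior_subset hx)).mono (interior_subset.trans hs)
  · rw [interior_Icc]; exact hp

lemma smono_of {f f' : ℝ → ℝ} {a b : ℝ} (ha : 0 ≤ a) (hb : b ≤ 1)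
    (h : ∀ x ∈ Icc a b, HasDerivWithinAt f (f' x) (Icc 0 1) x)
    (hp : ∀ x ∈ Ioo a b, 0 < f' x) : StrictMonoOn f (Icc a b) := by
  have hs : Icc a b ⊆ Icc 0 1 := Icc_subset_Icc ha hb
  apply strictMonoOn_of_hasDerivWithinAt_pos (convex_Icc a b) (f' := f')
  · exact fun x hx => ((h x hx).continuousWithinAt).mono hs
  · intro x hx
    exact (h x (interior_subset hx)).mono (interior_subset.trans hs)
  · rw [interior_Icc]; exact hp

lemma near_pt {f : ℝ → ℝ} {x0 : ℝ} (hx0 : x0 ∈ Icc (0:ℝ) 1) (hf : ContinuousOn f (Icc 0 1))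
    (h0 : 0 < f x0) : ∃ δ, 0 < δ ∧ δ < 1 ∧ ∀ x ∈ Icc (0:ℝ) 1, |x - x0| ≤ δ → 0 < f x := by
  have h := (hf x0 hx0).eventually (lt_mem_nhds h0)
  rw [eventually_nhdsWithin_iff, Metric.eventually_nhds_iff] at h
  obtain ⟨ε, hε, h⟩ := h
  refine ⟨min (ε/2) (1/2), by positivity, (min_le_right _ _).trans_lt (by norm_num), ?_⟩
  intro x hx hd
  refine h ?_ hx
  rw [Real.dist_eq]
  have := min_le_left (ε/2) (1/2)
  linarith

/-- a positive solution of the second order equation -/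
def PosSol (p : ℝ → ℝ) (lam : ℝ) (φ ψ : ℝ → ℝ) : Prop :=
  φ 0 = 0 ∧ ψ 0 = 1 ∧
  (∀ x ∈ Icc (0:ℝ) 1, HasDerivWithinAt φ (ψ x / p x) (Icc 0 1) x) ∧
  (∀ x ∈ Icc (0:ℝ) 1, HasDerivWithinAt ψ (-lam * φ x) (Icc 0 1) x) ∧
  (∀ x ∈ Ioc (0:ℝ) 1, 0 < φ x)

lemma exists_posSol (p : ℝ → ℝ) (lam : ℝ) (hpc : ContinuousOn p (Icc 0 1))
    (hp : ∀ x ∈ Icc (0:ℝ) 1, 0 < p x) (hlam : lam ∈ AdmSet p) : ∃ φ ψ, PosSol p lam φ ψ := by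
  set q : ℝ → ℝ := fun x => (p (cl x))⁻¹ with hqdef
  have hqc : Continuous q :=
    (hpc.comp_continuous cl_cont cl_mem).inv₀ (fun x => (hp _ (cl_mem x)).ne')
  have hq0 : ∀ x, 0 < q x := fun x => inv_pos.2 (hp _ (cl_mem x))
  obtain ⟨m, hm, hmm⟩ := isCompact_Icc.exists_isMaxOn (nonempty_Icc.2 (zero_le_one (α := ℝ)))
    hqc.continuousOn
  have hM : ∀ x, q x ≤ q m := by
    intro x
    have h := hmm (cl_mem x)
    simp only [hqdef, mem_ofPred_eq, cl_eq (cl_mem x)] at h ⊢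
    exact h
  obtain ⟨φ, ψ, hφc, hψc, h0, hφ, hψ, hneg⟩ := exists_phi q hqc (q m) hq0 hM
  have hqp : ∀ x ∈ Icc (0:ℝ) 1, q x = (p x)⁻¹ := fun x hx => by simp only [hqdef, cl_eq hx]
  have hφ' : ∀ μ, ∀ x ∈ Icc (0:ℝ) 1, HasDerivWithinAt (φ μ) (ψ μ x / p x) (Icc 0 1) x := by
    intro μ x hx
    have := hφ μ x hx
    rwa [hqp x hx, inv_mul_eq_div] at this
  have hφμ : ∀ μ, Continuous (φ μ) := fun μ => hφc.comp (by fun_prop : Continuous (fun x : ℝ => (μ, x)))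
  have hψμ : ∀ μ, Continuous (ψ μ) := fun μ => hψc.comp (by fun_prop : Continuous (fun x : ℝ => (μ, x)))
  have hφx : ∀ x, Continuous (fun μ => φ μ x) := fun x => hφc.comp (by fun_prop : Continuous (fun μ : ℝ => (μ, x)))
  refine ⟨φ lam, ψ lam, (h0 lam).1, (h0 lam).2, hφ' lam, hψ lam, ?_⟩
  rcases le_or_gt lam 0 with hl | hl
  · exact hneg lam hl
  by_contra hcon
  push Not at hcon
  obtain ⟨x1, hx1, hx1'⟩ := hcon
  obtain ⟨δ, hδ0, hδ1, hδ⟩ : ∃ δ, 0 < δ ∧ δ < 1 ∧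
      ∀ μ ∈ Icc 0 lam, ∀ x ∈ Ioc 0 δ, 0 < φ μ x := by
    have hpos : ∀ μ ∈ Icc 0 lam, ∀ᶠ z : ℝ × ℝ in nhds μ ×ˢ nhds (0:ℝ), 0 < ψ z.1 z.2 := by
      intro μ _
      rw [← nhds_prod_eq]
      apply hψc.continuousAt.eventually (lt_mem_nhds _)
      simp only [(h0 μ).2]; norm_num
    have hev : ∀ᶠ x in nhds (0:ℝ), ∀ μ ∈ Icc 0 lam, 0 < ψ μ x := by
      apply (isCompact_Icc (a := (0:ℝ)) (b := lam)).eventually_forall_of_forall_eventually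
      intro μ hμ
      have := hpos μ hμ
      rw [← nhds_prod_eq] at this
      exact (continuous_swap.tendsto ((0:ℝ), μ)).eventually this
    rw [Metric.eventually_nhds_iff] at hev
    obtain ⟨ε, hε, hev⟩ := hev
    refine ⟨min (ε/2) (1/2), by positivity, (min_le_right _ _).trans_lt (by norm_num), ?_⟩
    have hd1 := min_le_left (ε/2) (1/2)
    have hd2 := min_le_right (ε/2) (1/2)
    intro μ hμ x hx
    have hx1 : x ≤ 1 := by linarith [hx.2]
    have := smono_of (a := 0) (b := x) le_rfl hx1
      (fun t ht => hφ μ t ⟨ht.1, ht.2.trans hx1⟩)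
      (fun t ht => mul_pos (hq0 t) (hev (by
        rw [Real.dist_eq, sub_zero, abs_of_pos ht.1]; linarith [ht.2, hx.2]) μ hμ))
    have h2 := this ⟨le_rfl, hx.1.le⟩ ⟨hx.1.le, le_rfl⟩ hx.1
    rwa [(h0 μ).1] at h2
  set Z : Set (ℝ × ℝ) := (Icc 0 lam ×ˢ Icc δ 1) ∩ {z | φ z.1 z.2 ≤ 0} with hZ
  have hZc : IsCompact Z :=
    (isCompact_Icc.prod isCompact_Icc).inter_right (isClosed_le hφc continuous_const)
  have hx1δ : δ < x1 := by
    by_contra h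
    push Not at h
    exact absurd (hδ lam ⟨hl.le, le_rfl⟩ x1 ⟨hx1.1, h⟩) (not_lt.2 hx1')
  have hZn : Z.Nonempty := ⟨(lam, x1), ⟨⟨⟨hl.le, le_rfl⟩, ⟨hx1δ.le, hx1.2⟩⟩, hx1'⟩⟩
  obtain ⟨⟨μ, xs⟩, ⟨⟨hμ, hxs⟩, hle⟩, hmin⟩ := hZc.exists_isMinOn hZn continuous_fst.continuousOn
  simp only [mem_ofPred_eq] at hμ hxs hle
  have hbelow : ∀ ν ∈ Ico 0 μ, ∀ x ∈ Ioc (0:ℝ) 1, 0 < φ ν x := by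
    intro ν hν x hx
    have hν' : ν ∈ Icc 0 lam := ⟨hν.1, hν.2.le.trans hμ.2⟩
    rcases le_or_gt x δ with h | h
    · exact hδ ν hν' x ⟨hx.1, h⟩
    · by_contra hc
      push Not at hc
      have := hmin (show (ν, x) ∈ Z from ⟨⟨hν', ⟨h.le, hx.2⟩⟩, hc⟩)
      simp only [mem_ofPred_eq] at this
      linarith [hν.2]
  have hxs0 : xs ∈ Ioc (0:ℝ) 1 := ⟨hδ0.trans_le hxs.1, hxs.2⟩
  have hμ0 : 0 < μ := by
    rcases hμ.1.eq_or_lt with h | h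
    · exact absurd (hneg μ h.symm.le xs hxs0) (not_lt.2 hle)
    · exact h
  have hnn : ∀ x ∈ Icc (0:ℝ) 1, 0 ≤ φ μ x := by
    intro x hx
    rcases hx.1.eq_or_lt with h | h
    · rw [← h, (h0 μ).1]
    have ht : Filter.Tendsto (fun ν => φ ν x) (nhdsWithin μ (Iio μ)) (nhds (φ μ x)) :=
      ((hφx x).tendsto μ).mono_left nhdsWithin_le_nhds
    refine ge_of_tendsto ht ?_
    filter_upwards [Ico_mem_nhdsLT hμ0] with ν hν
    exact (hbelow ν hν x ⟨h, hx.2⟩).le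
  have hzero : φ μ xs = 0 := le_antisymm hle (hnn xs ⟨hxs0.1.le, hxs.2⟩)
  have hδpos := hδ μ hμ δ ⟨hδ0, le_rfl⟩
  have hx1eq : xs = 1 := by
    by_contra hne
    have hlt : xs < 1 := lt_of_le_of_ne hxs.2 hne
    have hder : HasDerivAt (φ μ) (q xs * ψ μ xs) xs :=
      (hφ μ xs ⟨hxs0.1.le, hxs.2⟩).hasDerivAt (Icc_mem_nhds hxs0.1 hlt)
    have hlm : IsLocalMin (φ μ) xs := by
      filter_upwards [Icc_mem_nhds hxs0.1 hlt] with x hx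
      rw [hzero]; exact hnn x hx
    have h1 := hlm.hasDerivAt_eq_zero hder
    have hψ0 : ψ μ xs = 0 := by
      rcases mul_eq_zero.1 h1 with h | h
      · exact absurd h (hq0 xs).ne'
      · exact h
    have hanti := anti_of (a := 0) (b := xs) le_rfl hxs.2
      (fun t ht => hψ μ t ⟨ht.1, ht.2.trans hxs.2⟩)
      (fun t ht => by
        have := hnn t ⟨ht.1.le, ht.2.le.trans hxs.2⟩
        nlinarith)
    have hmono := mono_of (a := δ) (b := xs) hδ0.le hxs.2
      (fun t ht => hφ μ t ⟨hδ0.le.trans ht.1, ht.2.trans hxs.2⟩)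
      (fun t ht => by
        have := hanti ⟨hδ0.le.trans ht.1.le, ht.2.le⟩ ⟨hxs0.1.le, le_rfl⟩ ht.2.le
        rw [hψ0] at this
        exact mul_nonneg (hq0 t).le this)
    have := hmono ⟨le_rfl, hxs.1⟩ ⟨hxs.1, le_rfl⟩ hxs.1
    rw [hzero] at this
    linarith
  have hu : UniqueDiffOn ℝ (Icc (0:ℝ) 1) := uniqueDiffOn_Icc zero_lt_one
  have hpd : ∀ x ∈ Icc (0:ℝ) 1, p x * Dv (φ μ) x = ψ μ x := by
    intro x hx
    unfold Dv
    rw [(hφ' μ x hx).derivWithin (hu x hx)]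
    have := (hp x hx).ne'
    field_simp
  have heig : DirichletEig p μ := by
    refine ⟨φ μ, ?_, ?_, ?_, ?_, (h0 μ).1, ?_⟩
    · exact C1_of _ _ (hφ μ) (hqc.mul (hψμ μ)).continuousOn
    · exact (C1_of _ _ (hψ μ) (continuous_const.mul (hφμ μ)).continuousOn).congr hpd
    · intro x hx
      have : Dv (fun t => p t * Dv (φ μ) t) x = -μ * φ μ x := by
        rw [Dv, derivWithin_congr hpd (hpd x hx)]
        exact (hψ μ x hx).derivWithin (hu x hx)
      rw [this]; ring
    · exact ⟨δ, ⟨hδ0.le, hδ1.le⟩, hδpos.ne'⟩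
    · rw [← hx1eq]; exact hzero
  exact absurd (hlam μ heig) (not_lt.2 hμ.2)

/-- first order system equivalent to the fourth order equation -/
def Sys (p r : ℝ → ℝ) (k lam : ℝ) (y w v T : ℝ → ℝ) : Prop :=
  ∀ x ∈ Icc (0:ℝ) 1, HasDerivWithinAt y (w x) (Icc 0 1) x ∧
    HasDerivWithinAt w (v x / p x) (Icc 0 1) x ∧
    HasDerivWithinAt v (T x - lam * w x) (Icc 0 1) x ∧
    HasDerivWithinAt T (k * r x * y x) (Icc 0 1) x

lemma Sys.lin {p r : ℝ → ℝ} {k lam : ℝ} {y w v T y' w' v' T' : ℝ → ℝ} (a b : ℝ)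
    (h : Sys p r k lam y w v T) (h' : Sys p r k lam y' w' v' T') :
    Sys p r k lam (fun x => a * y x + b * y' x) (fun x => a * w x + b * w' x)
      (fun x => a * v x + b * v' x) (fun x => a * T x + b * T' x) := by
  intro x hx
  obtain ⟨h1, h2, h3, h4⟩ := h x hx
  obtain ⟨g1, g2, g3, g4⟩ := h' x hx
  refine ⟨(h1.const_mul a).add (g1.const_mul b), ?_, ?_, ?_⟩
  · exact ((h2.const_mul a).add (g2.const_mul b)).congr_deriv (by ring)
  · exact ((h3.const_mul a).add (g3.const_mul b)).congr_deriv (by ring)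
  · exact ((h4.const_mul a).add (g4.const_mul b)).congr_deriv (by ring)

lemma Sys.neg {p r : ℝ → ℝ} {k lam : ℝ} {y w v T : ℝ → ℝ}
    (h : Sys p r k lam y w v T) :
    Sys p r k lam (fun x => - y x) (fun x => - w x) (fun x => - v x) (fun x => - T x) := by
  have := h.lin (-1) 0 h
  simpa using this

lemma derivD {p r : ℝ → ℝ} {k lam : ℝ} {y w v T φ ψ : ℝ → ℝ} (h : Sys p r k lam y w v T)
    (hφ : PosSol p lam φ ψ) : ∀ x ∈ Icc (0:ℝ) 1,
    HasDerivWithinAt (fun x => φ x * v x - w x * ψ x) (φ x * T x) (Icc 0 1) x := by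
  intro x hx
  obtain ⟨h1, h2, h3, h4⟩ := h x hx
  obtain ⟨_, _, g1, g2, _⟩ := hφ
  exact (((g1 x hx).mul h3).sub (h2.mul (g2 x hx))).congr_deriv (by ring)

lemma derivQ {p r : ℝ → ℝ} {k lam : ℝ} {y w v T φ ψ : ℝ → ℝ} (h : Sys p r k lam y w v T)
    (hφ : PosSol p lam φ ψ) : ∀ x ∈ Ioc (0:ℝ) 1,
    HasDerivWithinAt (fun x => w x / φ x) ((φ x * v x - w x * ψ x) / (p x * φ x ^ 2)) (Icc 0 1) x := by
  intro x hx
  have hx' : x ∈ Icc (0:ℝ) 1 := ⟨hx.1.le, hx.2⟩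
  obtain ⟨h1, h2, h3, h4⟩ := h x hx'
  obtain ⟨_, _, g1, g2, g3⟩ := hφ
  refine (h2.div (g1 x hx') (g3 x hx).ne').congr_deriv ?_
  rw [← div_div]
  congr 1
  ring

lemma caseA {p r : ℝ → ℝ} {k lam : ℝ} {y w v T φ ψ : ℝ → ℝ}
    (hp : ∀ x ∈ Icc (0:ℝ) 1, 0 < p x) (hr : ∀ x ∈ Icc (0:ℝ) 1, 0 < r x) (hk : 0 < k)
    (h : Sys p r k lam y w v T) (hφ : PosSol p lam φ ψ)
    (hy0 : y 0 = 0) (hw0 : w 0 = 0) (hv0 : v 0 = 0) (hT0 : 0 < T 0) : w 1 ≠ 0 := by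
  intro hw1
  have hwc : ContinuousOn w (Icc 0 1) := fun x hx => (h x hx).2.1.continuousWithinAt
  have hTc : ContinuousOn T (Icc 0 1) := fun x hx => (h x hx).2.2.2.continuousWithinAt
  obtain ⟨δ, hδ0, hδ1, hδ⟩ := near_pt (f := fun x => T x - lam * w x) (x0 := 0) (by simp)
    (hTc.sub (continuousOn_const.mul hwc)) (by simpa [hw0] using hT0)
  have hv := smono_of (f := v) (a := 0) (b := δ) le_rfl hδ1.le
    (fun x hx => (h x ⟨hx.1, hx.2.trans hδ1.le⟩).2.2.1)
    (fun x hx => hδ x ⟨hx.1.le, hx.2.le.trans hδ1.le⟩ (by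
      rw [sub_zero, abs_of_pos hx.1]; exact hx.2.le))
  have hvpos : ∀ x ∈ Ioc 0 δ, 0 < v x := fun x hx => by
    have := hv ⟨le_rfl, hδ0.le⟩ ⟨hx.1.le, hx.2⟩ hx.1
    rwa [hv0] at this
  have hw := smono_of (f := w) (a := 0) (b := δ) le_rfl hδ1.le
    (fun x hx => (h x ⟨hx.1, hx.2.trans hδ1.le⟩).2.1)
    (fun x hx => div_pos (hvpos x ⟨hx.1, hx.2.le⟩) (hp x ⟨hx.1.le, hx.2.le.trans hδ1.le⟩))
  have hwpos : ∀ x ∈ Ioc 0 δ, 0 < w x := fun x hx => by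
    have := hw ⟨le_rfl, hδ0.le⟩ ⟨hx.1.le, hx.2⟩ hx.1
    rwa [hw0] at this
  have hsub : Icc δ 1 ⊆ Icc (0:ℝ) 1 := Icc_subset_Icc hδ0.le le_rfl
  have hZc : IsCompact (Icc δ 1 ∩ w ⁻¹' {0}) :=
    isCompact_Icc.of_isClosed_subset ((hwc.mono hsub).preimage_isClosed_of_isClosed isClosed_Icc
      isClosed_singleton) inter_subset_left
  obtain ⟨s, ⟨hs, hws⟩, hleast⟩ := hZc.exists_isLeast ⟨1, ⟨hδ1.le, le_rfl⟩, hw1⟩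
  simp only [mem_preimage, mem_singleton_iff] at hws
  have hs0 : 0 < s := hδ0.trans_le hs.1
  have hδs : δ < s := by
    refine lt_of_le_of_ne hs.1 ?_
    intro he
    have := hwpos δ ⟨hδ0, le_rfl⟩
    rw [he, hws] at this
    exact lt_irrefl _ this
  have hwp : ∀ x ∈ Ioo 0 s, 0 < w x := by
    intro x hx
    rcases le_or_gt x δ with hxd | hxd
    · exact hwpos x ⟨hx.1, hxd⟩
    by_contra hc
    push Not at hc
    have hx1 : x ≤ 1 := hx.2.le.trans hs.2
    obtain ⟨z, hz, hz0⟩ := intermediate_value_Icc' hxd.le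
      (hwc.mono (Icc_subset_Icc hδ0.le hx1)) ⟨hc, (hwpos δ ⟨hδ0, le_rfl⟩).le⟩
    have := hleast ⟨⟨hz.1, hz.2.trans hx1⟩, hz0⟩
    linarith [hz.2, hx.2]
  have hin : ∀ x ∈ Icc 0 s, x ∈ Icc (0:ℝ) 1 := fun x hx => ⟨hx.1, hx.2.trans hs.2⟩
  have hym := mono_of (f := y) (a := 0) (b := s) le_rfl hs.2
    (fun x hx => (h x (hin x hx)).1) (fun x hx => (hwp x hx).le)
  have hyn : ∀ x ∈ Icc 0 s, 0 ≤ y x := fun x hx => by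
    have := hym ⟨le_rfl, hs0.le⟩ hx hx.1
    rwa [hy0] at this
  have hTm := mono_of (f := T) (a := 0) (b := s) le_rfl hs.2
    (fun x hx => (h x (hin x hx)).2.2.2) (fun x hx =>
      mul_nonneg (mul_pos hk (hr x (hin x ⟨hx.1.le, hx.2.le⟩))).le (hyn x ⟨hx.1.le, hx.2.le⟩))
  have hTp : ∀ x ∈ Icc 0 s, 0 < T x := fun x hx =>
    hT0.trans_le (hTm ⟨le_rfl, hs0.le⟩ hx hx.1)
  have hφp := hφ.2.2.2.2
  have hD := smono_of (a := 0) (b := s) le_rfl hs.2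
    (fun x hx => derivD h hφ x (hin x hx)) (fun x hx =>
      mul_pos (hφp x ⟨hx.1, hx.2.le.trans hs.2⟩) (hTp x ⟨hx.1.le, hx.2.le⟩))
  have hDp : ∀ x ∈ Ioc 0 s, 0 < φ x * v x - w x * ψ x := fun x hx => by
    have := hD ⟨le_rfl, hs0.le⟩ ⟨hx.1.le, hx.2⟩ hx.1
    simpa only [hφ.1, hw0, zero_mul, sub_zero] using this
  have hQ := smono_of (a := δ) (b := s) hδ0.le hs.2
    (fun x hx => derivQ h hφ x ⟨hδ0.trans_le hx.1, hx.2.trans hs.2⟩) (fun x hx => by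
      have hx0 : 0 < x := hδ0.trans hx.1
      have h1 := hDp x ⟨hx0, hx.2.le⟩
      have h2 := hφp x ⟨hx0, hx.2.le.trans hs.2⟩
      have h3 := hp x ⟨hx0.le, hx.2.le.trans hs.2⟩
      positivity)
  have h1 := hQ ⟨le_rfl, hs.1⟩ ⟨hs.1, le_rfl⟩ hδs
  simp only [hws, zero_div] at h1
  have h2 := div_pos (hwpos δ ⟨hδ0, le_rfl⟩) (hφp δ ⟨hδ0, hδ1.le⟩)
  linarith

lemma caseB {p r : ℝ → ℝ} {k lam : ℝ} {y w v T φ ψ : ℝ → ℝ}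
    (hp : ∀ x ∈ Icc (0:ℝ) 1, 0 < p x) (hr : ∀ x ∈ Icc (0:ℝ) 1, 0 < r x) (hk : 0 < k)
    (h : Sys p r k lam y w v T) (hφ : PosSol p lam φ ψ)
    (hy1 : y 1 = 0) (hw1 : w 1 = 0) (hT1 : T 1 = 0) (hv1 : 0 < v 1) : w 0 ≠ 0 := by
  intro hw0
  have hwc : ContinuousOn w (Icc 0 1) := fun x hx => (h x hx).2.1.continuousWithinAt
  have hvc : ContinuousOn v (Icc 0 1) := fun x hx => (h x hx).2.2.1.continuousWithinAt
  obtain ⟨δ, hδ0, hδ1, hδ⟩ := near_pt (f := v) (x0 := 1) (by simp) hvc hv1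
  set e := 1 - δ with he
  have he0 : 0 < e := by linarith
  have he1 : e < 1 := by linarith
  have hw := smono_of (f := w) (a := e) (b := 1) he0.le le_rfl
    (fun x hx => (h x ⟨he0.le.trans hx.1, hx.2⟩).2.1)
    (fun x hx => div_pos (hδ x ⟨he0.le.trans hx.1.le, hx.2.le⟩ (by
      rw [abs_le]; constructor <;> linarith [hx.1, hx.2]))
      (hp x ⟨he0.le.trans hx.1.le, hx.2.le⟩))
  have hwneg : ∀ x ∈ Ico e 1, w x < 0 := fun x hx => by
    have := hw ⟨hx.1, hx.2.le⟩ ⟨he1.le, le_rfl⟩ hx.2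
    rwa [hw1] at this
  have hsub : Icc 0 e ⊆ Icc (0:ℝ) 1 := Icc_subset_Icc le_rfl he1.le
  have hZc : IsCompact (Icc 0 e ∩ w ⁻¹' {0}) :=
    isCompact_Icc.of_isClosed_subset ((hwc.mono hsub).preimage_isClosed_of_isClosed isClosed_Icc
      isClosed_singleton) inter_subset_left
  obtain ⟨s, ⟨hs, hws⟩, hgr⟩ := hZc.exists_isGreatest ⟨0, ⟨le_rfl, he0.le⟩, hw0⟩
  simp only [mem_preimage, mem_singleton_iff] at hws
  have hs1 : s < 1 := hs.2.trans_lt he1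
  have hwn : ∀ x ∈ Ioo s 1, w x < 0 := by
    intro x hx
    rcases le_or_gt e x with hxd | hxd
    · exact hwneg x ⟨hxd, hx.2⟩
    by_contra hc
    push Not at hc
    have hx0 : 0 ≤ x := hs.1.trans hx.1.le
    obtain ⟨z, hz, hz0⟩ := intermediate_value_Icc' hxd.le
      (hwc.mono (Icc_subset_Icc hx0 he1.le)) ⟨(hwneg e ⟨le_rfl, he1⟩).le, hc⟩
    have := hgr ⟨⟨hx0.trans hz.1, hz.2⟩, hz0⟩
    linarith [hz.1, hx.1]
  have hin : ∀ x ∈ Icc s 1, x ∈ Icc (0:ℝ) 1 := fun x hx => ⟨hs.1.trans hx.1, hx.2⟩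
  have hym := anti_of (f := y) (a := s) (b := 1) hs.1 le_rfl
    (fun x hx => (h x (hin x hx)).1) (fun x hx => (hwn x hx).le)
  have hyn : ∀ x ∈ Icc s 1, 0 ≤ y x := fun x hx => by
    have := hym hx ⟨hs1.le, le_rfl⟩ hx.2
    rwa [hy1] at this
  have hTm := mono_of (f := T) (a := s) (b := 1) hs.1 le_rfl
    (fun x hx => (h x (hin x hx)).2.2.2) (fun x hx =>
      mul_nonneg (mul_pos hk (hr x (hin x ⟨hx.1.le, hx.2.le⟩))).le (hyn x ⟨hx.1.le, hx.2.le⟩))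
  have hTp : ∀ x ∈ Icc s 1, T x ≤ 0 := fun x hx => by
    have := hTm hx ⟨hs1.le, le_rfl⟩ hx.2
    rwa [hT1] at this
  have hφp := hφ.2.2.2.2
  have hD := anti_of (a := s) (b := 1) hs.1 le_rfl
    (fun x hx => derivD h hφ x (hin x hx)) (fun x hx =>
      mul_nonpos_of_nonneg_of_nonpos (hφp x ⟨hs.1.trans_lt hx.1, hx.2.le⟩).le
        (hTp x ⟨hx.1.le, hx.2.le⟩))
  have hDp : ∀ x ∈ Icc s 1, 0 < φ x * v x - w x * ψ x := fun x hx => by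
    have h1 := hD hx ⟨hs1.le, le_rfl⟩ hx.2
    have h2 := mul_pos (hφp 1 ⟨one_pos, le_rfl⟩) hv1
    simp only [hw1, zero_mul, sub_zero] at h1
    linarith
  rcases hs.1.eq_or_lt with h0 | h0
  · have := hDp s ⟨le_rfl, hs1.le⟩
    rw [hws, ← h0, hφ.1] at this
    simp at this
  have hQ := smono_of (a := s) (b := 1) h0.le le_rfl
    (fun x hx => derivQ h hφ x ⟨h0.trans_le hx.1, hx.2⟩) (fun x hx => by
      have hx0 : 0 < x := h0.trans hx.1
      have h1 := hDp x ⟨hx.1.le, hx.2.le⟩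
      have h2 := hφp x ⟨hx0, hx.2.le⟩
      have h3 := hp x ⟨hx0.le, hx.2.le⟩
      positivity)
  have h1 := hQ ⟨le_rfl, hs1.le⟩ ⟨hs1.le, le_rfl⟩ hs1
  simp only [hws, hw1, zero_div] at h1
  exact lt_irrefl _ h1

lemma uniq {p r : ℝ → ℝ} {k lam : ℝ} {y w v T : ℝ → ℝ}
    (hpc : ContinuousOn p (Icc 0 1)) (hrc : ContinuousOn r (Icc 0 1))
    (hp : ∀ x ∈ Icc (0:ℝ) 1, 0 < p x)
    (h : Sys p r k lam y w v T) (x0 : ℝ) (hx0 : x0 ∈ Icc (0:ℝ) 1)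
    (hy : y x0 = 0) (hw : w x0 = 0) (hv : v x0 = 0) (hT : T x0 = 0) :
    ∀ x ∈ Icc (0:ℝ) 1, y x = 0 := by
  obtain ⟨M, hM⟩ := isCompact_Icc.exists_bound_of_continuousOn
    (hpc.inv₀ (fun x hx => (hp x hx).ne'))
  obtain ⟨R, hR⟩ := isCompact_Icc.exists_bound_of_continuousOn hrc
  set C := 2 + M + |lam| + |k| * R with hC
  set E : ℝ → ℝ := fun x => y x ^ 2 + w x ^ 2 + v x ^ 2 + T x ^ 2 with hE
  set E' : ℝ → ℝ := fun x => 2 * y x * w x + 2 * w x * (v x / p x) + 2 * v x * (T x - lam * w x)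
    + 2 * T x * (k * r x * y x) with hE'
  have hd : ∀ x ∈ Icc (0:ℝ) 1, HasDerivWithinAt E (E' x) (Icc 0 1) x := by
    intro x hx
    obtain ⟨h1, h2, h3, h4⟩ := h x hx
    exact ((((h1.pow 2).add (h2.pow 2)).add (h3.pow 2)).add (h4.pow 2)).congr_deriv (by
      simp only [hE']; norm_num)
  have key : ∀ a b c d : ℝ, |c| ≤ d → |2 * a * b * c| ≤ d * (a^2 + b^2) := by
    intro a b c d hcd
    rw [abs_mul]
    have h1 : |2 * a * b| ≤ a^2 + b^2 := by
      rw [abs_le]; constructor <;> nlinarith [sq_nonneg (a+b), sq_nonneg (a-b)]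
    calc |2 * a * b| * |c| ≤ (a^2+b^2) * d := mul_le_mul h1 hcd (abs_nonneg _) (by positivity)
      _ = _ := by ring
  have hbd : ∀ x ∈ Icc (0:ℝ) 1, |E' x| ≤ C * E x := by
    intro x hx
    have b1 := key (y x) (w x) 1 1 (by simp)
    have b2 := key (w x) (v x) (p x)⁻¹ M (hM x hx)
    have b3 := key (v x) (T x) 1 1 (by simp)
    have b4 := key (v x) (w x) lam |lam| le_rfl
    have b5 := key (T x) (y x) (k * r x) (|k| * R) (by
      rw [abs_mul]; exact mul_le_mul_of_nonneg_left (hR x hx) (abs_nonneg _))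
    have hM0 : 0 ≤ M := (norm_nonneg _).trans (hM x hx)
    have hR0 : 0 ≤ |k| * R := mul_nonneg (abs_nonneg _) ((norm_nonneg _).trans (hR x hx))
    have hl0 := abs_nonneg lam
    have e : E' x = 2 * y x * w x * 1 + 2 * w x * v x * (p x)⁻¹ + 2 * v x * T x * 1
      - 2 * v x * w x * lam + 2 * T x * y x * (k * r x) := by
      simp only [hE']; ring
    have hsum : C * E x = (1 * (y x^2 + w x^2) + M * (w x^2 + v x^2) + 1 * (v x^2 + T x^2)
        + |lam| * (v x^2 + w x^2) + |k| * R * (T x^2 + y x^2))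
        + ((1 + M + |lam|) * y x^2 + (M + |lam| + 1) * T x^2 + (1 + |k| * R) * w x^2 
          + (1 + |k| * R) * v x^2 - M * y x^2 * 0 ) - (M * 0) := by
      simp only [hC, hE]; ring
    have n1 : 0 ≤ ((1 + M + |lam|) * y x^2 + (M + |lam| + 1) * T x^2 + (1 + |k| * R) * w x^2 
          + (1 + |k| * R) * v x^2) := by positivity
    rw [e, hsum, abs_le]
    rw [abs_le] at b1 b2 b3 b4 b5
    constructor <;> linarith [b1.1, b2.1, b3.1, b4.1, b5.1, b1.2, b2.2, b3.2, b4.2, b5.2]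
  have hexp : ∀ a x : ℝ, HasDerivWithinAt (fun x => Real.exp (a * x)) (a * Real.exp (a * x)) (Icc 0 1) x := by
    intro a x
    have := ((hasDerivAt_id x).const_mul a).exp.hasDerivWithinAt (s := Icc 0 1)
    exact this.congr_deriv (by simp; ring)
  have hup := mono_of (a := 0) (b := 1) le_rfl le_rfl
    (fun x hx => (hd x hx).mul (hexp C x)) (fun x hx => by
      have h1 := (abs_le.1 (hbd x ⟨hx.1.le, hx.2.le⟩)).1
      have h2 := Real.exp_pos (C * x)
      nlinarith)
  have hdn := anti_of (a := 0) (b := 1) le_rfl le_rfl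
    (fun x hx => (hd x hx).mul (hexp (-C) x)) (fun x hx => by
      have h1 := (abs_le.1 (hbd x ⟨hx.1.le, hx.2.le⟩)).2
      have h2 := Real.exp_pos (-C * x)
      nlinarith)
  have hE0 : E x0 = 0 := by simp [hE, hy, hw, hv, hT]
  intro x hx
  have hle : E x ≤ 0 := by
    rcases le_total x x0 with hxx | hxx
    · have := hup hx hx0 hxx
      simp only [Pi.mul_apply, hE0, zero_mul] at this
      have h2 := Real.exp_pos (C * x)
      by_contra hc
      push Not at hc
      linarith [mul_pos hc h2]
    · have := hdn hx0 hx hxx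
      simp only [Pi.mul_apply, hE0, zero_mul] at this
      have h2 := Real.exp_pos (-C * x)
      by_contra hc
      push Not at hc
      linarith [mul_pos hc h2]
  have : y x ^ 2 = 0 := by
    simp only [hE] at hle
    nlinarith [sq_nonneg (y x), sq_nonneg (w x), sq_nonneg (v x), sq_nonneg (T x)]
  exact pow_eq_zero_iff (two_ne_zero) |>.1 this

lemma kpos {p r : ℝ → ℝ} {k lam : ℝ} {y w v T φ ψ : ℝ → ℝ}
    (hp : ∀ x ∈ Icc (0:ℝ) 1, 0 < p x) (hr : ∀ x ∈ Icc (0:ℝ) 1, 0 < r x)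
    (h : Sys p r k lam y w v T) (hφ : PosSol p lam φ ψ)
    (hy0 : y 0 = 0) (hw0 : w 0 = 0) (hy1 : y 1 = 0) (hw1 : w 1 = 0)
    (hn : Nontriv y) : 0 < k := by
  by_contra hk
  push Not at hk
  obtain ⟨hφ0, hψ0, hφd, hψd, hφp⟩ := id hφ
  have hI0 : (0:ℝ) ∈ Icc (0:ℝ) 1 := by simp
  set g : ℝ → ℝ := fun x => v x * w x - w x * (w x / φ x) * ψ x - y x * T x with hg
  have hgd : ∀ x ∈ Ioc (0:ℝ) 1, HasDerivWithinAt g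
      (-k * r x * y x ^ 2 + (v x - w x * ψ x / φ x)^2 / p x) (Icc 0 1) x := by
    intro x hx
    have hx' : x ∈ Icc (0:ℝ) 1 := ⟨hx.1.le, hx.2⟩
    obtain ⟨h1, h2, h3, h4⟩ := h x hx'
    have hf := (hφp x hx).ne'
    have hpx := (hp x hx').ne'
    refine (((h3.mul h2).sub ((h2.mul (derivQ h hφ x hx)).mul (hψd x hx'))).sub
      (h1.mul h4)).congr_deriv ?_
    simp only [Pi.mul_apply]
    field_simp
    ring
  have hwφ : Filter.Tendsto (fun x => w x / φ x) (nhdsWithin 0 (Icc 0 1 \ {0}))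
      (nhds ((v 0 / p 0) / (ψ 0 / p 0))) := by
    have h1 := hasDerivWithinAt_iff_tendsto_slope.1 (h 0 hI0).2.1
    have h2 := hasDerivWithinAt_iff_tendsto_slope.1 (hφd 0 hI0)
    have hne : ψ 0 / p 0 ≠ 0 := by
      rw [hψ0]; exact div_ne_zero one_ne_zero (hp 0 hI0).ne'
    refine (h1.div h2 hne).congr' ?_
    filter_upwards [self_mem_nhdsWithin] with x hx
    have hx0 : x ≠ 0 := hx.2
    have hf := (hφp x ⟨lt_of_le_of_ne hx.1.1 (Ne.symm hx0), hx.1.2⟩).ne'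
    simp only [Pi.div_apply, slope_def_field, hw0, hφ0, sub_zero]
    field_simp
  have hgc : ContinuousOn g (Icc 0 1) := by
    intro x hx
    rcases hx.1.eq_or_lt with h0 | h0
    · rw [← h0]
      rw [← continuousWithinAt_diff_self]
      have hle : nhdsWithin (0:ℝ) (Icc 0 1 \ {0}) ≤ nhdsWithin 0 (Icc 0 1) :=
        nhdsWithin_mono _ diff_subset
      obtain ⟨h1, h2, h3, h4⟩ := h 0 hI0
      have c1 := h1.continuousWithinAt.tendsto.mono_left hle
      have c2 := h2.continuousWithinAt.tendsto.mono_left hle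
      have c3 := h3.continuousWithinAt.tendsto.mono_left hle
      have c4 := h4.continuousWithinAt.tendsto.mono_left hle
      have c5 := (hψd 0 hI0).continuousWithinAt.tendsto.mono_left hle
      have := ((c3.mul c2).sub ((c2.mul hwφ).mul c5)).sub (c1.mul c4)
      unfold ContinuousWithinAt
      convert this using 2
      simp [hg, hw0, hy0]
    · exact (hgd x ⟨h0, hx.2⟩).continuousWithinAt
  have hnn : ∀ x ∈ Ioo (0:ℝ) 1, 0 ≤ -k * r x * y x ^ 2 := by
    intro x hx
    have := hr x ⟨hx.1.le, hx.2.le⟩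
    have : 0 ≤ -k := by linarith
    positivity
  have hnn2 : ∀ x ∈ Ioo (0:ℝ) 1, 0 ≤ (v x - w x * ψ x / φ x)^2 / p x := by
    intro x hx
    have := hp x ⟨hx.1.le, hx.2.le⟩
    positivity
  have hmono : MonotoneOn g (Icc 0 1) := by
    apply monotoneOn_of_hasDerivWithinAt_nonneg (convex_Icc 0 1) hgc
      (f' := fun x => -k * r x * y x ^ 2 + (v x - w x * ψ x / φ x)^2 / p x)
    · intro x hx
      rw [interior_Icc] at hx ⊢
      exact (hgd x ⟨hx.1, hx.2.le⟩).mono Ioo_subset_Icc_self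
    · intro x hx
      rw [interior_Icc] at hx
      exact add_nonneg (hnn x hx) (hnn2 x hx)
  have hg0 : ∀ x ∈ Icc (0:ℝ) 1, g x = 0 := by
    intro x hx
    have h1 := hmono hI0 hx hx.1
    have h2 := hmono hx (by simp) hx.2
    simp only [hg, hw0, hy0, hw1, hy1] at h1 h2 ⊢
    apply le_antisymm <;> linarith
  have hD : ∀ x ∈ Ioo (0:ℝ) 1, φ x * v x - w x * ψ x = 0 := by
    intro x hx
    have hd := (hgd x ⟨hx.1, hx.2.le⟩).hasDerivAt (Icc_mem_nhds hx.1 hx.2)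
    have hd0 : HasDerivAt g 0 x := (hasDerivAt_const x (0:ℝ)).congr_of_eventuallyEq (by
      filter_upwards [Icc_mem_nhds hx.1 hx.2] with z hz
      exact hg0 z hz)
    have he := hd.unique hd0
    have h2 : (v x - w x * ψ x / φ x)^2 / p x = 0 := by linarith [hnn x hx, hnn2 x hx]
    have hpx := (hp x ⟨hx.1.le, hx.2.le⟩).ne'
    have hf := (hφp x ⟨hx.1, hx.2.le⟩).ne'
    have h3 : v x - w x * ψ x / φ x = 0 := by
      rcases div_eq_zero_iff.1 h2 with h | h
      · exact pow_eq_zero_iff two_ne_zero |>.1 h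
      · exact absurd h hpx
    have h4 : φ x * (v x - w x * ψ x / φ x) = 0 := by rw [h3, mul_zero]
    rw [← h4]; field_simp
  have hwz : ∀ x ∈ Ioo (0:ℝ) 1, w x = 0 := by
    intro x hx
    have hin : ∀ t ∈ Icc x 1, t ∈ Ioc (0:ℝ) 1 := fun t ht => ⟨hx.1.trans_le ht.1, ht.2⟩
    have hz : ∀ t ∈ Ioo x 1, (φ t * v t - w t * ψ t) / (p t * φ t ^ 2) = 0 := fun t ht => by
      rw [hD t ⟨hx.1.trans ht.1, ht.2⟩, zero_div]
    have m1 := mono_of (a := x) (b := 1) hx.1.le le_rfl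
      (fun t ht => derivQ h hφ t (hin t ht)) (fun t ht => (hz t ht).ge)
    have m2 := anti_of (a := x) (b := 1) hx.1.le le_rfl
      (fun t ht => derivQ h hφ t (hin t ht)) (fun t ht => (hz t ht).le)
    have l1 := m1 ⟨le_rfl, hx.2.le⟩ ⟨hx.2.le, le_rfl⟩ hx.2.le
    have l2 := m2 ⟨le_rfl, hx.2.le⟩ ⟨hx.2.le, le_rfl⟩ hx.2.le
    have l3 : w x / φ x = 0 := by
      simp only [hw1, zero_div] at l1 l2
      exact le_antisymm l1 l2
    rcases div_eq_zero_iff.1 l3 with h | h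
    · exact h
    · exact absurd h (hφp x ⟨hx.1, hx.2.le⟩).ne'
  obtain ⟨x, hx, hyx⟩ := hn
  have m1 := mono_of (a := 0) (b := 1) le_rfl le_rfl
    (fun t ht => (h t ht).1) (fun t ht => (hwz t ht).ge)
  have m2 := anti_of (a := 0) (b := 1) le_rfl le_rfl
    (fun t ht => (h t ht).1) (fun t ht => (hwz t ht).le)
  have l1 := m1 hI0 hx hx.1
  have l2 := m2 hI0 hx hx.1
  rw [hy0] at l1 l2
  exact hyx (le_antisymm l2 l1)

lemma dv_has {f : ℝ → ℝ} (hf : ContDiffOn ℝ 1 f (Icc 0 1)) :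
    ∀ x ∈ Icc (0:ℝ) 1, HasDerivWithinAt f (Dv f x) (Icc 0 1) x := fun x hx =>
  ((hf.differentiableOn (by norm_num)) x hx).hasDerivWithinAt

lemma dv_c1 {f : ℝ → ℝ} (hf : ContDiffOn ℝ 2 f (Icc 0 1)) : ContDiffOn ℝ 1 (Dv f) (Icc 0 1) :=
  hf.derivWithin (uniqueDiffOn_Icc zero_lt_one) (by norm_num)

lemma sys_of (p r : ℝ → ℝ) (c lam : ℝ) (y : ℝ → ℝ) (hp : ∀ x ∈ Icc (0:ℝ) 1, 0 < p x)
    (h : SolT p r c lam y) : Sys p r (lam * c) lam y (Dv y) (fun x => p x * Dv (Dv y) x)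
      (fun x => Dv (fun t => p t * Dv (Dv y) t) x + lam * Dv y x) := by
  obtain ⟨h1, h2, h3⟩ := h
  intro x hx
  have hpx := (hp x hx).ne'
  refine ⟨dv_has (h1.of_le (by norm_num)) x hx, ?_, ?_, ?_⟩
  · exact (dv_has (dv_c1 h1) x hx).congr_deriv (by field_simp)
  · exact (dv_has (h2.of_le (by norm_num)) x hx).congr_deriv (by ring)
  · refine ((dv_has (dv_c1 h2) x hx).add ((dv_has (dv_c1 h1) x hx).const_mul lam)).congr_deriv ?_
    linarith [h3 x hx]

lemma caseA' {p r : ℝ → ℝ} {k lam : ℝ} {y w v T φ ψ : ℝ → ℝ}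
    (hp : ∀ x ∈ Icc (0:ℝ) 1, 0 < p x) (hr : ∀ x ∈ Icc (0:ℝ) 1, 0 < r x) (hk : 0 < k)
    (h : Sys p r k lam y w v T) (hφ : PosSol p lam φ ψ)
    (hy0 : y 0 = 0) (hw0 : w 0 = 0) (hv0 : v 0 = 0) (hw1 : w 1 = 0) : T 0 = 0 := by
  rcases lt_trichotomy (T 0) 0 with hT | hT | hT
  · exact absurd (by simp [hw1]) (caseA hp hr hk h.neg hφ (by simp [hy0]) (by simp [hw0])
      (by simp [hv0]) (by linarith))
  · exact hT
  · exact absurd hw1 (caseA hp hr hk h hφ hy0 hw0 hv0 hT)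

lemma caseB' {p r : ℝ → ℝ} {k lam : ℝ} {y w v T φ ψ : ℝ → ℝ}
    (hp : ∀ x ∈ Icc (0:ℝ) 1, 0 < p x) (hr : ∀ x ∈ Icc (0:ℝ) 1, 0 < r x) (hk : 0 < k)
    (h : Sys p r k lam y w v T) (hφ : PosSol p lam φ ψ)
    (hy1 : y 1 = 0) (hw1 : w 1 = 0) (hT1 : T 1 = 0) (hw0 : w 0 = 0) : v 1 = 0 := by
  rcases lt_trichotomy (v 1) 0 with hv | hv | hv
  · exact absurd (by simp [hw0]) (caseB hp hr hk h.neg hφ (by simp [hy1]) (by simp [hw1])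
      (by simp [hT1]) (by linarith))
  · exact hv
  · exact absurd hw0 (caseB hp hr hk h hφ hy1 hw1 hT1 hv)

lemma final_sys {p r : ℝ → ℝ} {k lam alpha : ℝ} {y w v T y' w' v' T' φ ψ : ℝ → ℝ}
    (hpc : ContinuousOn p (Icc 0 1)) (hrc : ContinuousOn r (Icc 0 1))
    (hp : ∀ x ∈ Icc (0:ℝ) 1, 0 < p x) (hr : ∀ x ∈ Icc (0:ℝ) 1, 0 < r x)
    (h : Sys p r k lam y w v T) (h' : Sys p r k lam y' w' v' T') (hφ : PosSol p lam φ ψ)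
    (hn : Nontriv y) (hn' : Nontriv y')
    (hy0 : y 0 = 0) (hw0 : w 0 = 0) (hy1 : y 1 = 0) (hw1 : w 1 = 0)
    (hy0' : y' 0 = 0) (hw0' : w' 0 = 0) (hw1' : w' 1 = 0)
    (hT' : T' 1 + lam * alpha * y' 1 = 0) : False := by
  have hk := kpos hp hr h hφ hy0 hw0 hy1 hw1 hn
  have hI0 : (0:ℝ) ∈ Icc (0:ℝ) 1 := by simp
  have hI1 : (1:ℝ) ∈ Icc (0:ℝ) 1 := by simp
  have hv0 : v 0 ≠ 0 := by
    intro hv0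
    obtain ⟨x, hx, hyx⟩ := hn
    exact hyx (uniq hpc hrc hp h 0 hI0 hy0 hw0 hv0
      (caseA' hp hr hk h hφ hy0 hw0 hv0 hw1) x hx)
  have hl := h.lin (v' 0) (-v 0) h'
  have hlT := caseA' hp hr hk hl hφ (by simp [hy0, hy0']) (by simp [hw0, hw0']) (by ring)
    (by simp [hw1, hw1'])
  have hz := uniq hpc hrc hp hl 0 hI0 (by simp [hy0, hy0']) (by simp [hw0, hw0']) (by ring) hlT
    1 hI1
  have hy1' : y' 1 = 0 := by
    simp only [hy1, mul_zero, zero_add] at hz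
    rcases mul_eq_zero.1 hz with h | h
    · exact absurd (neg_eq_zero.1 h) hv0
    · exact h
  have hT1' : T' 1 = 0 := by rw [hy1'] at hT'; linarith
  obtain ⟨x, hx, hyx⟩ := hn'
  exact hyx (uniq hpc hrc hp h' 1 hI1 hy1' hw1'
    (caseB' hp hr hk h' hφ hy1' hw1' hT1' hw0') hT1' x hx)

theorem stmt_10 (p r : ℝ → ℝ) (c alpha lam : ℝ)
    (hpc : ContinuousOn p (Icc 0 1)) (hrc : ContinuousOn r (Icc 0 1))
    (hp : ∀ x ∈ Icc (0:ℝ) 1, 0 < p x) (hr : ∀ x ∈ Icc (0:ℝ) 1, 0 < r x)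
    (hlam : lam ∈ AdmSet p) :
    ¬ ((∃ y : ℝ → ℝ, SolT p r c lam y ∧ Nontriv y ∧ BC1 y) ∧
       (∃ y : ℝ → ℝ, SolT p r c lam y ∧ Nontriv y ∧ BC2 p lam alpha y)) := by
  rintro ⟨⟨y, hy, hn, b1, b2, b3, b4⟩, ⟨z, hz, hn', c1, c2, c3, c4⟩⟩
  obtain ⟨φ, ψ, hφ⟩ := exists_posSol p lam hpc hp hlam
  exact final_sys (alpha := alpha) hpc hrc hp hr (sys_of p r c lam y hp hy)
    (sys_of p r c lam z hp hz) hφ hn hn'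
    b1 b2 b3 b4 c1 c2 c3 (by simp only [c3]; linarith)
end
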